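/- arXiv:2509.09497 — 5 statements merged into one kernel-verified Lean document; each statement's English description precedes it below -/
import Mathlib

section
/- Let λ ≥ 0 and let δ be a real number with −(1/2)·√(1+4λ) < δ < (1/2)·√(1+4λ). Suppose u : {(x,y) ∈ ℝ² : x > 0} → ℝ is twice continuously differentiable, satisfies −x²(∂²u/∂x² + ∂²u/∂y²) + λ·u = 0 at every point of the half-plane, and satisfies ∫₀^∞ ∫_ℝ x^(−2δ−2) |u(x,y)|² dy dx < ∞. Then u is identically zero. -/
open MeasureTheory

open Set

/-- Restriction of a differentiable function of two variables to a horizontal line. -/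
lemma hasDerivAt_horizontal {f : ℝ × ℝ → ℝ} {p : ℝ × ℝ} (h : DifferentiableAt ℝ f p) :
    HasDerivAt (fun s => f (s, p.2)) (fderiv ℝ f p (1, 0)) p.1 :=
  HasFDerivAt.comp_hasDerivAt (x := p.1) (f := fun s => (s, p.2)) h.hasFDerivAt
    ((hasDerivAt_id _).prodMk (hasDerivAt_const _ _))

/-- Restriction of a differentiable function of two variables to a vertical line. -/
lemma hasDerivAt_vertical {f : ℝ × ℝ → ℝ} {p : ℝ × ℝ} (h : DifferentiableAt ℝ f p) :
    HasDerivAt (fun s => f (p.1, s)) (fderiv ℝ f p (0, 1)) p.2 :=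
  HasFDerivAt.comp_hasDerivAt (x := p.2) (f := fun s => (p.1, s)) h.hasFDerivAt
    ((hasDerivAt_const _ _).prodMk (hasDerivAt_id _))

lemma isOpen_halfPlane : IsOpen {p : ℝ × ℝ | 0 < p.1} :=
  isOpen_lt continuous_const continuous_fst

/-- The second order equation in coordinates, expressed with iterated Fréchet derivatives. -/
lemma iteratedDeriv_two_add_eq_fderiv {U : ℝ × ℝ → ℝ}
    (hU : ContDiffOn ℝ 2 U {p : ℝ × ℝ | 0 < p.1}) {p : ℝ × ℝ} (hp : 0 < p.1) :
    iteratedDeriv 2 (fun s => U (s, p.2)) p.1 + iteratedDeriv 2 (fun s => U (p.1, s)) p.2 =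
      fderiv ℝ (fun q => fderiv ℝ U q (1, 0)) p (1, 0) +
        fderiv ℝ (fun q => fderiv ℝ U q (0, 1)) p (0, 1) := by
  have hd : ∀ q : ℝ × ℝ, 0 < q.1 → DifferentiableAt ℝ U q := fun q hq =>
    (hU.differentiableOn (by norm_num)).differentiableAt (isOpen_halfPlane.mem_nhds hq)
  have hf : DifferentiableAt ℝ (fderiv ℝ U) p :=
    ((hU.fderiv_of_isOpen (m := 1) isOpen_halfPlane (by norm_num)).differentiableOn
      (by norm_num)).differentiableAt (isOpen_halfPlane.mem_nhds hp)
  have h1 := hasDerivAt_horizontal (f := fun q => fderiv ℝ U q (1, 0)) (p := p)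
    (hf.clm_apply (differentiableAt_const _))
  have h2 := hasDerivAt_vertical (f := fun q => fderiv ℝ U q (0, 1)) (p := p)
    (hf.clm_apply (differentiableAt_const _))
  simp only [iteratedDeriv_succ, iteratedDeriv_zero]
  rw [← h1.deriv, ← h2.deriv]
  congr 1
  · apply Filter.EventuallyEq.deriv_eq
    filter_upwards [lt_mem_nhds hp] with s hs
    exact (hasDerivAt_horizontal (p := (s, p.2)) (hd _ hs)).deriv
  · congr 1
    funext s
    exact (hasDerivAt_vertical (p := (p.1, s)) (hd _ hp)).deriv

/-- Weighted energy inequality on a rectangle: a consequence of Green's identity and of Hardy's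
inequality in the first variable. -/
lemma setIntegral_energy_nonpos {lam : ℝ} {U φ : ℝ × ℝ → ℝ}
    (hU : ContDiffOn ℝ 2 U {p : ℝ × ℝ | 0 < p.1})
    (hφ : ContDiffOn ℝ 1 φ {p : ℝ × ℝ | 0 < p.1})
    (hpde : ∀ p : ℝ × ℝ, 0 < p.1 →
      fderiv ℝ (fun q => fderiv ℝ U q (1, 0)) p (1, 0) +
        fderiv ℝ (fun q => fderiv ℝ U q (0, 1)) p (0, 1) = lam * U p / p.1 ^ 2)
    {a b : ℝ × ℝ} (ha : 0 < a.1) (hab : a ≤ b)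
    (hl : ∀ y, φ (a.1, y) = 0) (hr : ∀ y, φ (b.1, y) = 0)
    (hb : ∀ x, φ (x, a.2) = 0) (ht : ∀ x, φ (x, b.2) = 0) :
    ∫ p in Icc a b, ((lam + 1 / 4) * (φ p * U p) ^ 2 / p.1 ^ 2 -
      U p ^ 2 * ((fderiv ℝ φ p (1, 0)) ^ 2 + (fderiv ℝ φ p (0, 1)) ^ 2)) ≤ 0 := by
  set H : Set (ℝ × ℝ) := {p | 0 < p.1} with hH
  have hHo : IsOpen H := isOpen_halfPlane
  have hsub : Icc a b ⊆ H := fun p hp => lt_of_lt_of_le ha hp.1.1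
  have hU1 : ContDiffOn ℝ 1 U H := hU.of_le (by norm_num)
  have hfU : ContDiffOn ℝ 1 (fderiv ℝ U) H := hU.fderiv_of_isOpen hHo (by norm_num)
  have hUx : ContDiffOn ℝ 1 (fun q => fderiv ℝ U q (1, 0)) H :=
    hfU.clm_apply contDiffOn_const
  have hUy : ContDiffOn ℝ 1 (fun q => fderiv ℝ U q (0, 1)) H :=
    hfU.clm_apply contDiffOn_const
  have hinv : ContDiffOn ℝ 1 (fun q : ℝ × ℝ => (q.1)⁻¹) H :=
    contDiff_fst.contDiffOn.inv fun q hq => (ne_of_gt hq)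
  set F : ℝ × ℝ → ℝ := fun q => φ q ^ 2 * U q * fderiv ℝ U q (1, 0) -
    (φ q * U q) ^ 2 * q.1⁻¹ / 2 with hF
  set G : ℝ × ℝ → ℝ := fun q => φ q ^ 2 * U q * fderiv ℝ U q (0, 1) with hG
  have hFc : ContDiffOn ℝ 1 F H :=
    (((hφ.pow 2).mul hU1).mul hUx).sub ((((hφ.mul hU1).pow 2).mul hinv).div_const 2)
  have hGc : ContDiffOn ℝ 1 G H := ((hφ.pow 2).mul hU1).mul hUy
  have hdiff : ∀ {f : ℝ × ℝ → ℝ}, ContDiffOn ℝ 1 f H → ∀ p ∈ H, DifferentiableAt ℝ f p :=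
    fun hf p hp => (hf.differentiableOn (by norm_num)).differentiableAt (hHo.mem_nhds hp)
  have hcont : ∀ {f : ℝ × ℝ → ℝ}, ContDiffOn ℝ 1 f H → ∀ v : ℝ × ℝ,
      ContinuousOn (fun p => fderiv ℝ f p v) (Icc a b) := fun hf v =>
    ((hf.continuousOn_fderiv_of_isOpen hHo le_rfl).mono hsub).clm_apply continuousOn_const
  have hiF : IntegrableOn (fun p => fderiv ℝ F p (1, 0) + fderiv ℝ G p (0, 1)) (Icc a b) :=
    ((hcont hFc _).add (hcont hGc _)).integrableOn_compact isCompact_Icc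
  have hsubo : Ioo a.1 b.1 ×ˢ Ioo a.2 b.2 ⊆ H := fun p hp => ha.trans hp.1.1
  have hdiv := integral_divergence_prod_Icc_of_hasFDerivAt_of_le F G (fderiv ℝ F) (fderiv ℝ G)
    a b hab (hFc.continuousOn.mono hsub) (hGc.continuousOn.mono hsub)
    (fun p hp => (hdiff hFc p (hsubo hp)).hasFDerivAt)
    (fun p hp => (hdiff hGc p (hsubo hp)).hasFDerivAt) hiF
  simp only [hF, hG, hl, hr, hb, ht] at hdiv
  simp only [← hF, ← hG] at hdiv
  norm_num at hdiv
  refine le_of_le_of_eq ?_ hdiv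
  refine setIntegral_mono_on ?_ hiF measurableSet_Icc fun p hp => ?_
  · apply ContinuousOn.integrableOn_compact isCompact_Icc
    have h1 := hcont hφ (1, 0)
    have h2 := hcont hφ (0, 1)
    have h3 := hφ.continuousOn.mono hsub
    have h4 := hU.continuousOn.mono hsub
    have h5 : ContinuousOn (fun q : ℝ × ℝ => q.1 ^ 2) (Icc a b) := by fun_prop
    exact ((continuousOn_const.mul ((h3.mul h4).pow 2)).div h5
      fun q hq => (pow_pos (hsub hq) 2).ne').sub ((h4.pow 2).mul ((h1.pow 2).add (h2.pow 2)))
  have hpH := hsub hp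
  have hx : 0 < p.1 := hpH
  have eF := (hasDerivAt_horizontal (hdiff hFc p hpH)).unique
    (((((hasDerivAt_horizontal (hdiff hφ p hpH)).pow 2).mul
      (hasDerivAt_horizontal (hdiff hU1 p hpH))).mul (hasDerivAt_horizontal (hdiff hUx p hpH))).sub
      ((((hasDerivAt_horizontal (hdiff hφ p hpH)).mul
        (hasDerivAt_horizontal (hdiff hU1 p hpH))).pow 2).mul
        (hasDerivAt_inv hx.ne') |>.div_const 2))
  have eG := (hasDerivAt_vertical (hdiff hGc p hpH)).unique
    ((((hasDerivAt_vertical (hdiff hφ p hpH)).pow 2).mul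
      (hasDerivAt_vertical (hdiff hU1 p hpH))).mul (hasDerivAt_vertical (hdiff hUy p hpH)))
  have hp' := hpde p hx
  rw [eF, eG]
  generalize fderiv ℝ (fun q => fderiv ℝ U q (1, 0)) p (1, 0) = Uxx at *
  generalize fderiv ℝ (fun q => fderiv ℝ U q (0, 1)) p (0, 1) = Uyy at *
  generalize fderiv ℝ U p (1, 0) = Ux at *
  generalize fderiv ℝ U p (0, 1) = Uy at *
  generalize fderiv ℝ φ p (1, 0) = φx at *
  generalize fderiv ℝ φ p (0, 1) = φy at *
  obtain rfl : Uyy = lam * U p / p.1 ^ 2 - Uxx := by linarith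
  have key : 0 ≤ (φx * U p + φ p * Ux - φ p * U p * p.1⁻¹ / 2) ^ 2 +
    (φy * U p + φ p * Uy) ^ 2 := by positivity
  rw [← sub_nonneg]
  refine key.trans_eq ?_
  simp only [Pi.mul_apply, Pi.pow_apply, Prod.mk.eta, Nat.cast_ofNat, Nat.add_one_sub_one, pow_one]
  ring

/-- The logarithmic cutoff used to test the equation. -/
noncomputable def logCutoff (δ R L : ℝ) (p : ℝ × ℝ) : ℝ :=
  p.1 ^ (-δ) * ((1 - (Real.log p.1 / R) ^ 2) * (1 - (p.2 / L) ^ 2))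

lemma contDiffOn_logCutoff (δ R L : ℝ) :
    ContDiffOn ℝ 1 (logCutoff δ R L) {p : ℝ × ℝ | 0 < p.1} := by
  have h1 : ContDiffOn ℝ 1 (fun p : ℝ × ℝ => p.1) {p : ℝ × ℝ | 0 < p.1} :=
    contDiff_fst.contDiffOn
  have h2 : ContDiffOn ℝ 1 (fun p : ℝ × ℝ => p.2) {p : ℝ × ℝ | 0 < p.1} :=
    contDiff_snd.contDiffOn
  have h0 : ∀ p ∈ {p : ℝ × ℝ | 0 < p.1}, p.1 ≠ 0 := fun p hp => ne_of_gt hp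
  exact (h1.rpow_const_of_ne h0).mul ((contDiffOn_const.sub (((h1.log h0).div_const R).pow 2)).mul
    (contDiffOn_const.sub ((h2.div_const L).pow 2)))

lemma fderiv_logCutoff_sq_add_sq (δ R L : ℝ) {p : ℝ × ℝ} (hp : 0 < p.1) :
    (fderiv ℝ (logCutoff δ R L) p (1, 0)) ^ 2 + (fderiv ℝ (logCutoff δ R L) p (0, 1)) ^ 2 =
      p.1 ^ (-2 * δ - 2) *
        ((δ * ((1 - (Real.log p.1 / R) ^ 2) * (1 - (p.2 / L) ^ 2)) +
          2 * Real.log p.1 / R ^ 2 * (1 - (p.2 / L) ^ 2)) ^ 2 +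
        ((1 - (Real.log p.1 / R) ^ 2) * (2 * p.1 * p.2 / L ^ 2)) ^ 2) := by
  have hd : DifferentiableAt ℝ (logCutoff δ R L) p :=
    ((contDiffOn_logCutoff δ R L).differentiableOn (by norm_num)).differentiableAt
      (isOpen_halfPlane.mem_nhds hp)
  have e1 := (hasDerivAt_horizontal hd).unique
    ((Real.hasDerivAt_rpow_const (p := -δ) (Or.inl hp.ne')).mul
      (((((Real.hasDerivAt_log hp.ne').div_const R).pow 2).const_sub 1).mul_const
        (1 - (p.2 / L) ^ 2)))
  have e2 := (hasDerivAt_vertical hd).unique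
    ((((((hasDerivAt_id p.2).div_const L).pow 2).const_sub 1).const_mul
      (1 - (Real.log p.1 / R) ^ 2)).const_mul (p.1 ^ (-δ)))
  have h1 : p.1 ^ (-δ) = p.1 ^ (-δ - 1) * p.1 := by
    rw [← Real.rpow_add_one hp.ne']; congr 1; ring
  have h2 : p.1 ^ (-2 * δ - 2) = (p.1 ^ (-δ - 1)) ^ 2 := by
    rw [← Real.rpow_mul_natCast hp.le]; congr 1; push_cast; ring
  rw [e1, e2, h1, h2]
  simp only [div_eq_mul_inv, id, Nat.cast_ofNat, Nat.add_one_sub_one, pow_one, one_mul]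
  have hx := mul_inv_cancel₀ hp.ne'
  generalize p.1 ^ (-δ - 1) = A
  generalize Real.log p.1 = t
  generalize p.1⁻¹ = z at *
  linear_combination (A ^ 2 * ((1 - (p.2 * L⁻¹) ^ 2) * 2 * t * R⁻¹ ^ 2) ^ 2 * (p.1 * z + 1) +
    4 * A ^ 2 * δ * t * R⁻¹ ^ 2 * (1 - (t * R⁻¹) ^ 2) * (1 - (p.2 * L⁻¹) ^ 2) ^ 2) * hx

/-- Pointwise bound for the gradient of the logarithmic cutoff on its rectangle. -/
lemma fderiv_logCutoff_le {δ R : ℝ} (hR : 1 ≤ R) {p : ℝ × ℝ} (hp : 0 < p.1)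
    (h1 : |Real.log p.1| ≤ R) (h2 : |p.2| ≤ R * Real.exp R) :
    (fderiv ℝ (logCutoff δ R (R * Real.exp R)) p (1, 0)) ^ 2 +
      (fderiv ℝ (logCutoff δ R (R * Real.exp R)) p (0, 1)) ^ 2 ≤
    p.1 ^ (-2 * δ - 2) *
      (δ ^ 2 * ((1 - (Real.log p.1 / R) ^ 2) * (1 - (p.2 / (R * Real.exp R)) ^ 2)) ^ 2 +
        (4 * |δ| + 8) / R) := by
  rw [fderiv_logCutoff_sq_add_sq δ R _ hp]
  apply mul_le_mul_of_nonneg_left _ (by positivity)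
  have hR0 : 0 < R := by linarith
  have hL : 0 < R * Real.exp R := by positivity
  have hxL : p.1 / (R * Real.exp R) ≤ 1 / R := by
    have : p.1 ≤ Real.exp R := by
      rw [← Real.exp_log hp]; exact Real.exp_le_exp.2 (le_of_abs_le h1)
    rw [div_le_div_iff₀ hL hR0]
    nlinarith
  have hxL0 : 0 ≤ p.1 / (R * Real.exp R) := by positivity
  have hs : |Real.log p.1 / R| ≤ 1 := by
    rw [abs_div, abs_of_pos hR0]; exact (div_le_one hR0).2 h1
  have hw : |p.2 / (R * Real.exp R)| ≤ 1 := by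
    rw [abs_div, abs_of_pos hL]; exact (div_le_one hL).2 h2
  rw [show 2 * Real.log p.1 / R ^ 2 = 2 * (Real.log p.1 / R) * (1 / R) by field_simp,
    show 2 * p.1 * p.2 / (R * Real.exp R) ^ 2 =
      2 * (p.2 / (R * Real.exp R)) * (p.1 / (R * Real.exp R)) by field_simp,
    div_eq_mul_one_div (4 * |δ| + 8) R]
  have hr0 : 0 < 1 / R := by positivity
  have hr1 : 1 / R ≤ 1 := (div_le_one hR0).2 hR
  generalize 1 / R = r at *
  generalize p.1 / (R * Real.exp R) = ξ at *
  generalize Real.log p.1 / R = s at *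
  generalize p.2 / (R * Real.exp R) = w at *
  have hs2 : s ^ 2 ≤ 1 := (sq_le_one_iff_abs_le_one s).2 hs
  have hw2 : w ^ 2 ≤ 1 := (sq_le_one_iff_abs_le_one w).2 hw
  have hα : |1 - s ^ 2| ≤ 1 := abs_le.2 ⟨by linarith, by nlinarith⟩
  have hβ : |1 - w ^ 2| ≤ 1 := abs_le.2 ⟨by linarith, by nlinarith⟩
  have hχ : |(1 - s ^ 2) * (1 - w ^ 2)| ≤ 1 := by
    rw [abs_mul]; exact mul_le_one₀ hα (abs_nonneg _) hβ
  have he : |2 * s * r * (1 - w ^ 2)| ≤ 2 * r := by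
    rw [abs_mul, abs_mul, abs_mul, abs_of_pos hr0, abs_two]
    calc 2 * |s| * r * |1 - w ^ 2| ≤ 2 * 1 * r * 1 := by gcongr
      _ = 2 * r := by ring
  have hg : |(1 - s ^ 2) * (2 * w * ξ)| ≤ 2 * r := by
    rw [abs_mul, abs_mul, abs_mul, abs_of_nonneg hxL0, abs_two]
    calc |1 - s ^ 2| * (2 * |w| * ξ) ≤ 1 * (2 * 1 * r) := by gcongr
      _ = 2 * r := by ring
  generalize (1 - s ^ 2) * (1 - w ^ 2) = χ at *
  generalize 2 * s * r * (1 - w ^ 2) = e at *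
  generalize (1 - s ^ 2) * (2 * w * ξ) = g at *
  have hr2 : (2 * r) ^ 2 ≤ 4 * r := by nlinarith
  have he2 : e ^ 2 ≤ (2 * r) ^ 2 := sq_le_sq' (abs_le.1 he).1 (abs_le.1 he).2
  have hg2 : g ^ 2 ≤ (2 * r) ^ 2 := sq_le_sq' (abs_le.1 hg).1 (abs_le.1 hg).2
  have hc : δ * χ * e ≤ |δ| * 1 * (2 * r) := by
    refine (le_abs_self _).trans ?_
    rw [abs_mul, abs_mul]
    gcongr
  nlinarith

/-- On half of its rectangle, the logarithmic cutoff is bounded below. -/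
lemma one_fourth_le_cutoff_sq {s w : ℝ} (hs : |s| ≤ 1 / 2) (hw : |w| ≤ 1 / 2) :
    1 / 4 ≤ ((1 - s ^ 2) * (1 - w ^ 2)) ^ 2 := by
  have h1 : s ^ 2 ≤ (1 / 2) ^ 2 := sq_le_sq' (abs_le.1 hs).1 (abs_le.1 hs).2
  have h2 : w ^ 2 ≤ (1 / 2) ^ 2 := sq_le_sq' (abs_le.1 hw).1 (abs_le.1 hw).2
  have h3 : 1 / 2 ≤ (1 - s ^ 2) * (1 - w ^ 2) := by nlinarith
  nlinarith

/-- The rectangle `[exp (-R), exp R] × [-L, L]` in logarithmic coordinates. -/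
lemma abs_log_le_of_mem_Icc {R L : ℝ} {p : ℝ × ℝ}
    (hp : p ∈ Icc (Real.exp (-R), -L) (Real.exp R, L)) :
    0 < p.1 ∧ |Real.log p.1| ≤ R ∧ |p.2| ≤ L := by
  have h0 : 0 < p.1 := (Real.exp_pos _).trans_le hp.1.1
  exact ⟨h0, abs_le.2 ⟨(Real.le_log_iff_exp_le h0).2 hp.1.1,
    (Real.log_le_iff_le_exp h0).2 hp.2.1⟩, abs_le.2 ⟨hp.1.2, hp.2.2⟩⟩

/-- Quantitative smallness of the weighted norm on a fixed rectangle. -/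
lemma setIntegral_weighted_sq_le {lam δ : ℝ} {U : ℝ × ℝ → ℝ}
    (hδ : δ ^ 2 < lam + 1 / 4)
    (hU : ContDiffOn ℝ 2 U {p : ℝ × ℝ | 0 < p.1})
    (hpde : ∀ p : ℝ × ℝ, 0 < p.1 →
      fderiv ℝ (fun q => fderiv ℝ U q (1, 0)) p (1, 0) +
        fderiv ℝ (fun q => fderiv ℝ U q (0, 1)) p (0, 1) = lam * U p / p.1 ^ 2)
    (hint : IntegrableOn (fun p : ℝ × ℝ => p.1 ^ (-2 * δ - 2) * U p ^ 2) {p : ℝ × ℝ | 0 < p.1})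
    {r R : ℝ} (hR : 1 ≤ R) (hrR : 2 * r ≤ R) :
    (lam + 1 / 4 - δ ^ 2) / 4 *
        ∫ p in Icc (Real.exp (-r), -r) (Real.exp r, r), p.1 ^ (-2 * δ - 2) * U p ^ 2 ≤
      (4 * |δ| + 8) / R * ∫ p in {p : ℝ × ℝ | 0 < p.1}, p.1 ^ (-2 * δ - 2) * U p ^ 2 := by
  set f : ℝ × ℝ → ℝ := fun p => p.1 ^ (-2 * δ - 2) * U p ^ 2 with hf
  set H : Set (ℝ × ℝ) := {p | 0 < p.1} with hH
  have hHo : IsOpen H := isOpen_halfPlane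
  set L := R * Real.exp R with hL
  set χ : ℝ × ℝ → ℝ := fun p => (1 - (Real.log p.1 / R) ^ 2) * (1 - (p.2 / L) ^ 2) with hχ
  set Q : Set (ℝ × ℝ) := Icc (Real.exp (-R), -L) (Real.exp R, L) with hQ
  set K : Set (ℝ × ℝ) := Icc (Real.exp (-r), -r) (Real.exp r, r) with hK
  have hR0 : 0 < R := by linarith
  have hRL : R ≤ L := le_mul_of_one_le_right hR0.le (Real.one_le_exp hR0.le)
  have hL0 : 0 < L := by linarith
  have hQH : Q ⊆ H := fun p hp => (abs_log_le_of_mem_Icc hp).1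
  have hKQ : K ⊆ Q := Icc_subset_Icc
    ⟨Real.exp_le_exp.2 (by linarith), by simp; linarith⟩
    ⟨Real.exp_le_exp.2 (by linarith), by simp; linarith⟩
  have hfc : ContinuousOn f H :=
    (continuous_fst.continuousOn.rpow_const fun p hp => Or.inl (ne_of_gt hp)).mul
      (hU.continuousOn.pow 2)
  have hf0 : ∀ p ∈ H, 0 ≤ f p := fun p hp =>
    mul_nonneg (Real.rpow_nonneg (le_of_lt hp) _) (sq_nonneg _)
  have hχc : ContinuousOn χ Q := by
    have h1 : ContinuousOn (fun p : ℝ × ℝ => Real.log p.1) Q :=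
      continuous_fst.continuousOn.log fun p hp => ne_of_gt (hQH hp)
    exact (continuousOn_const.sub ((h1.div_const R).pow 2)).mul
      (Continuous.continuousOn (by fun_prop))
  have hfχ : IntegrableOn (fun p => (lam + 1 / 4 - δ ^ 2) * (f p * χ p ^ 2)) Q :=
    (continuousOn_const.mul ((hfc.mono hQH).mul (hχc.pow 2))).integrableOn_compact isCompact_Icc
  have hfQ : IntegrableOn f Q := hint.mono_set hQH
  have hφc := contDiffOn_logCutoff δ R L
  have hen := setIntegral_energy_nonpos (lam := lam) hU hφc hpde
    (a := (Real.exp (-R), -L)) (b := (Real.exp R, L)) (Real.exp_pos _)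
    ⟨Real.exp_le_exp.2 (by linarith), by simp; linarith⟩
    (fun y => by simp [logCutoff, hR0.ne']) (fun y => by simp [logCutoff, hR0.ne'])
    (fun x => by simp [logCutoff, hL0.ne']) (fun x => by simp [logCutoff, hL0.ne'])
  have hpt : ∫ p in Q, ((lam + 1 / 4 - δ ^ 2) * (f p * χ p ^ 2) - (4 * |δ| + 8) / R * f p) ≤
      ∫ p in Q, ((lam + 1 / 4) * (logCutoff δ R L p * U p) ^ 2 / p.1 ^ 2 -
        U p ^ 2 * ((fderiv ℝ (logCutoff δ R L) p (1, 0)) ^ 2 +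
          (fderiv ℝ (logCutoff δ R L) p (0, 1)) ^ 2)) := by
    refine setIntegral_mono_on (hfχ.sub (hfQ.const_mul _)) ?_ measurableSet_Icc fun p hp => ?_
    · apply ContinuousOn.integrableOn_compact isCompact_Icc
      have hd := (hφc.continuousOn_fderiv_of_isOpen hHo le_rfl).mono hQH
      have h1 : ContinuousOn (fun p => fderiv ℝ (logCutoff δ R L) p (1, 0)) Q :=
        hd.clm_apply continuousOn_const
      have h2 : ContinuousOn (fun p => fderiv ℝ (logCutoff δ R L) p (0, 1)) Q :=
        hd.clm_apply continuousOn_const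
      have h3 := hφc.continuousOn.mono hQH
      have h4 := hU.continuousOn.mono hQH
      have h5 : ContinuousOn (fun q : ℝ × ℝ => q.1 ^ 2) Q := by fun_prop
      exact ((continuousOn_const.mul ((h3.mul h4).pow 2)).div h5
        fun q hq => (pow_pos (hQH hq) 2).ne').sub ((h4.pow 2).mul ((h1.pow 2).add (h2.pow 2)))
    obtain ⟨h0, h1, h2⟩ := abs_log_le_of_mem_Icc hp
    have hgrad := mul_le_mul_of_nonneg_left (fderiv_logCutoff_le (δ := δ) hR h0 h1 h2)
      (sq_nonneg (U p))
    have hφ2 : (logCutoff δ R L p * U p) ^ 2 / p.1 ^ 2 = f p * χ p ^ 2 := by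
      have : p.1 ^ (-2 * δ - 2) = (p.1 ^ (-δ)) ^ 2 / p.1 ^ 2 := by
        rw [← Real.rpow_mul_natCast h0.le, ← Real.rpow_natCast p.1 2, ← Real.rpow_sub h0]
        congr 1; push_cast; ring
      simp only [hf, hχ, logCutoff, this]
      ring
    rw [mul_div_assoc, hφ2]
    calc (lam + 1 / 4 - δ ^ 2) * (f p * χ p ^ 2) - (4 * |δ| + 8) / R * f p
        = (lam + 1 / 4) * (f p * χ p ^ 2) -
          U p ^ 2 * (p.1 ^ (-2 * δ - 2) * (δ ^ 2 * χ p ^ 2 + (4 * |δ| + 8) / R)) := by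
          simp only [hf]; ring
      _ ≤ _ := sub_le_sub_left hgrad _
  rw [integral_sub hfχ (hfQ.const_mul _), integral_const_mul (_ / R)] at hpt
  have hlow : (lam + 1 / 4 - δ ^ 2) / 4 * ∫ p in K, f p ≤
      ∫ p in Q, (lam + 1 / 4 - δ ^ 2) * (f p * χ p ^ 2) := by
    rw [← integral_const_mul]
    refine (setIntegral_mono_on ((hfQ.mono_set hKQ).const_mul _) (hfχ.mono_set hKQ)
      measurableSet_Icc fun p hp => ?_).trans (setIntegral_mono_set hfχ ?_ hKQ.eventuallyLE)
    · obtain ⟨h0, h1, h2⟩ := abs_log_le_of_mem_Icc hp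
      have hχp : 1 / 4 ≤ χ p ^ 2 := by
        apply one_fourth_le_cutoff_sq
        · rw [abs_div, abs_of_pos hR0, div_le_iff₀ hR0]; linarith
        · rw [abs_div, abs_of_pos hL0, div_le_iff₀ hL0]; linarith
      have := mul_le_mul_of_nonneg_left hχp (mul_nonneg (sub_pos.2 hδ).le (hf0 p h0))
      linarith
    · filter_upwards [ae_restrict_mem measurableSet_Icc] with p hp
      exact mul_nonneg (sub_pos.2 hδ).le (mul_nonneg (hf0 p (hQH hp)) (sq_nonneg _))
  have hup : ∫ p in Q, f p ≤ ∫ p in H, f p := by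
    refine setIntegral_mono_set hint ?_ hQH.eventuallyLE
    filter_upwards [ae_restrict_mem hHo.measurableSet] with p hp using hf0 p hp
  have := mul_le_mul_of_nonneg_left hup (show 0 ≤ (4 * |δ| + 8) / R by positivity)
  linarith

/-- Vanishing of weighted-L² solutions of `Δ u + λ u = 0` on the hyperbolic half-plane,
where `Δ = -x²(∂ₓ² + ∂_y²)` and `u ∈ ρ^δ L²` with `ρ(x,y) = x`. -/
theorem no_harmonic_on_halfspace
    (lam δ : ℝ) (hlam : 0 ≤ lam)
    (hδl : -(1/2) * Real.sqrt (1 + 4 * lam) < δ)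
    (hδu : δ < (1/2) * Real.sqrt (1 + 4 * lam))
    (u : ℝ → ℝ → ℝ)
    (hreg : ContDiffOn ℝ 2 (fun p : ℝ × ℝ => u p.1 p.2) {p : ℝ × ℝ | 0 < p.1})
    (hpde : ∀ x y : ℝ, 0 < x →
      -(x ^ 2) * (iteratedDeriv 2 (fun s => u s y) x + iteratedDeriv 2 (fun s => u x s) y)
        + lam * u x y = 0)
    (hint : IntegrableOn
      (fun p : ℝ × ℝ => p.1 ^ (-2 * δ - 2) * (u p.1 p.2) ^ 2)
      {p : ℝ × ℝ | 0 < p.1} volume) :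
    ∀ x y : ℝ, 0 < x → u x y = 0 := by
  set U : ℝ × ℝ → ℝ := fun p => u p.1 p.2 with hUdef
  set f : ℝ × ℝ → ℝ := fun p => p.1 ^ (-2 * δ - 2) * U p ^ 2 with hf
  have hδ : δ ^ 2 < lam + 1 / 4 := by
    have h := sq_lt_sq' (by linarith) hδu
    rw [mul_pow, Real.sq_sqrt (by linarith)] at h
    linarith
  have hpde' : ∀ p : ℝ × ℝ, 0 < p.1 →
      fderiv ℝ (fun q => fderiv ℝ U q (1, 0)) p (1, 0) +
        fderiv ℝ (fun q => fderiv ℝ U q (0, 1)) p (0, 1) = lam * U p / p.1 ^ 2 := by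
    intro p hp
    rw [← iteratedDeriv_two_add_eq_fderiv hreg hp, eq_div_iff (pow_pos hp 2).ne']
    have := hpde p.1 p.2 hp
    simp only [hUdef]
    linarith
  intro x y hx
  set r := |Real.log x| + |y| + 1 with hr
  have hlx := abs_nonneg (Real.log x)
  have hly := abs_nonneg y
  set K : Set (ℝ × ℝ) := Icc (Real.exp (-r), -r) (Real.exp r, r) with hK
  have hKH : K ⊆ {p : ℝ × ℝ | 0 < p.1} := fun p hp => (abs_log_le_of_mem_Icc hp).1
  have hf0 : 0 ≤ᵐ[volume.restrict K] f := by
    filter_upwards [ae_restrict_mem measurableSet_Icc] with p hp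
    exact mul_nonneg (Real.rpow_nonneg (le_of_lt (hKH hp)) _) (sq_nonneg _)
  have hlim : (lam + 1 / 4 - δ ^ 2) / 4 * ∫ p in K, f p ≤ 0 := by
    have ht : Filter.Tendsto (fun R : ℝ => (4 * |δ| + 8) / R * ∫ p in {p : ℝ × ℝ | 0 < p.1}, f p)
        Filter.atTop (nhds 0) := by
      simpa using (tendsto_const_nhds.div_atTop Filter.tendsto_id).mul_const
        (∫ p in {p : ℝ × ℝ | 0 < p.1}, f p)
    refine ge_of_tendsto ht ?_
    filter_upwards [Filter.eventually_ge_atTop 1, Filter.eventually_ge_atTop (2 * r)] with R h1 h2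
    exact setIntegral_weighted_sq_le hδ hreg hpde' hint h1 h2
  have hzero : ∫ p in K, f p = 0 :=
    le_antisymm (nonpos_of_mul_nonpos_right hlim (by linarith)) (integral_nonneg_of_ae hf0)
  rw [setIntegral_eq_zero_iff_of_nonneg_ae hf0 (hint.mono_set hKH)] at hzero
  set V : Set (ℝ × ℝ) := Ioo (Real.exp (-r)) (Real.exp r) ×ˢ Ioo (-r) r with hV
  have hVK : V ⊆ K := fun p hp => ⟨⟨hp.1.1.le, hp.2.1.le⟩, ⟨hp.1.2.le, hp.2.2.le⟩⟩
  have hfc : ContinuousOn f V :=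
    (continuous_fst.continuousOn.rpow_const fun p hp => Or.inl (ne_of_gt (hKH (hVK hp)))).mul
      ((hreg.continuousOn.mono (hVK.trans hKH)).pow 2)
  have hmem : (x, y) ∈ V :=
    ⟨⟨(Real.lt_log_iff_exp_lt hx).1 (by linarith [neg_abs_le (Real.log x)]),
      (Real.log_lt_iff_lt_exp hx).1 (by linarith [le_abs_self (Real.log x)])⟩,
      by linarith [neg_abs_le y], by linarith [le_abs_self y]⟩
  have h := Measure.eqOn_open_of_ae_eq (ae_restrict_of_ae_restrict_of_subset hVK hzero)
    (isOpen_Ioo.prod isOpen_Ioo) hfc continuousOn_const hmem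
  simpa [hf, hUdef, (Real.rpow_pos_of_pos hx _).ne'] using h
end

section
/- Suppose u : {(x,y) ∈ ℝ² : x > 0} → ℝ is twice continuously differentiable and Euclidean-harmonic on the open half-plane, i.e. ∂²u/∂x² + ∂²u/∂y² = 0 at every point with x > 0, and suppose there is a real number δ with 0 < δ < 1 such that |u(x,y)| ≤ x^δ for all x > 0 and all y ∈ ℝ. Then u is identically zero. -/
open Set Filter Topology

/-- The second derivative of a `C²` function is nonpositive at a local maximum. -/
theorem IsLocalMax.iteratedDeriv_two_nonpos {f : ℝ → ℝ} {a : ℝ} (h : IsLocalMax f a)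
    (hf : ContDiffAt ℝ 2 f a) : iteratedDeriv 2 f a ≤ 0 := by
  by_contra! hpos
  have h2 : iteratedDeriv 2 f = deriv (deriv f) := by
    rw [iteratedDeriv_succ, iteratedDeriv_one]
  rw [h2] at hpos
  have hmin := isLocalMin_of_deriv_deriv_pos hpos h.deriv_eq_zero hf.continuousAt
  have hconst : f =ᶠ[𝓝 a] fun _ => f a := by
    filter_upwards [h, hmin] with s h₁ h₂ using le_antisymm h₁ h₂
  rw [hconst.deriv.deriv_eq] at hpos
  simp at hpos

theorem iteratedDeriv_two_quadratic (a b c x : ℝ) :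
    iteratedDeriv 2 (fun s : ℝ => a * s ^ 2 + b * s + c) x = 2 * a := by
  have h1 : deriv (fun s : ℝ => a * s ^ 2 + b * s + c) = fun s => 2 * a * s + b := by
    funext s
    have h := ((((hasDerivAt_id s).pow 2).const_mul a).add
      ((hasDerivAt_id s).const_mul b)).add_const c
    refine HasDerivAt.deriv (HasDerivAt.congr_deriv h ?_)
    simp
    ring
  have h2 : HasDerivAt (fun s : ℝ => 2 * a * s + b) (2 * a) x := by
    simpa using ((hasDerivAt_id x).const_mul (2 * a)).add_const b
  rw [iteratedDeriv_succ, iteratedDeriv_one, h1, h2.deriv]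

/-- If `f` minus a quadratic polynomial has a local maximum, the second derivative of `f` there is
at most that of the polynomial. -/
theorem IsLocalMax.iteratedDeriv_two_le {f : ℝ → ℝ} {a b c x : ℝ}
    (h : IsLocalMax (fun s => f s - (a * s ^ 2 + b * s + c)) x) (hf : ContDiffAt ℝ 2 f x) :
    iteratedDeriv 2 f x ≤ 2 * a := by
  have hq : ContDiffAt ℝ 2 (fun s : ℝ => a * s ^ 2 + b * s + c) x := by fun_prop
  have := h.iteratedDeriv_two_nonpos (hf.sub hq)
  rw [iteratedDeriv_fun_sub hf hq, iteratedDeriv_two_quadratic] at this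
  linarith

/-- Comparison with a strictly superharmonic quadratic barrier on a strip. -/
theorem le_strip_barrier_of_harmonic
    {δ : ℝ} (hδ0 : 0 < δ) {u : ℝ → ℝ → ℝ}
    (hreg : ContDiffOn ℝ 2 (fun p : ℝ × ℝ => u p.1 p.2) {p : ℝ × ℝ | 0 < p.1})
    (hpde : ∀ x y : ℝ, 0 < x →
      iteratedDeriv 2 (fun s => u s y) x + iteratedDeriv 2 (fun s => u x s) y = 0)
    (hbd : ∀ x y : ℝ, 0 < x → u x y ≤ x ^ δ)
    {x y X κ η : ℝ} (hx : 0 < x) (hxX : x < X) (hκ : 0 < κ) (hη : 0 < η) :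
    u x y ≤ X ^ (δ - 1) * x + κ * (y ^ 2 + 2 * X ^ 2 - 2 * x ^ 2) + η := by
  have hX : 0 < X := hx.trans hxX
  obtain ⟨x₀, hx₀, hx₀x, hx₀η⟩ : ∃ x₀ : ℝ, 0 < x₀ ∧ x₀ < x ∧ x₀ ^ δ ≤ η := by
    have ht : Tendsto (fun t : ℝ => t ^ δ) (𝓝[>] 0) (𝓝 0) := by
      have := (Real.continuousAt_rpow_const 0 δ (Or.inr hδ0.le)).tendsto
      rw [Real.zero_rpow hδ0.ne'] at this
      exact this.mono_left nhdsWithin_le_nhds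
    obtain ⟨t, ht₁, ht₂⟩ := ((ht.eventually_le_const hη).and (Ioo_mem_nhdsGT hx)).exists
    exact ⟨t, ht₂.1, ht₂.2, ht₁⟩
  obtain ⟨Y, hyY, hY⟩ : ∃ Y : ℝ, |y| < Y ∧ X ^ δ ≤ κ * Y ^ 2 := by
    have ht : Tendsto (fun t : ℝ => κ * t ^ 2) atTop atTop :=
      (tendsto_pow_atTop two_ne_zero).const_mul_atTop hκ
    exact ((eventually_gt_atTop |y|).and (ht.eventually_ge_atTop (X ^ δ))).exists
  set A : ℝ := X ^ (δ - 1) with hA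
  have hA0 : 0 < A := Real.rpow_pos_of_pos hX _
  have hAX : A * X = X ^ δ := by
    rw [hA, Real.rpow_sub_one hX.ne', div_mul_cancel₀ _ hX.ne']
  set w : ℝ × ℝ → ℝ := fun p =>
    u p.1 p.2 - (A * p.1 + κ * (p.2 ^ 2 + 2 * X ^ 2 - 2 * p.1 ^ 2)) with hw
  set K : Set (ℝ × ℝ) := Icc x₀ X ×ˢ Icc (-Y) Y with hK
  have hpos : ∀ p ∈ K, 0 < p.1 := fun p hp => hx₀.trans_le hp.1.1
  have hcont : ContinuousOn w K := by
    refine (hreg.continuousOn.mono hpos).sub (Continuous.continuousOn ?_)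
    fun_prop
  have hxy : (x, y) ∈ K := ⟨⟨hx₀x.le, hxX.le⟩, (abs_lt.1 hyY).1.le, (abs_lt.1 hyY).2.le⟩
  obtain ⟨⟨a, b⟩, hab, hmax⟩ := (isCompact_Icc.prod isCompact_Icc).exists_isMaxOn ⟨_, hxy⟩ hcont
  have ha : 0 < a := hpos _ hab
  obtain ⟨⟨hxa, haX⟩, hYb, hbY⟩ := hab
  simp only at hxa haX hYb hbY
  suffices hle : w (a, b) ≤ η by
    have := (hmax hxy).trans hle
    simp only [hw] at this
    linarith
  have hu := hbd a b ha
  have haX2 : 0 ≤ κ * (2 * X ^ 2 - 2 * a ^ 2) := by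
    apply mul_nonneg hκ.le
    nlinarith
  have hb2 : 0 ≤ κ * b ^ 2 := by positivity
  have hAa : 0 ≤ A * a := by positivity
  rcases hxa.eq_or_lt with rfl | hxa
  · simp only [hw]
    linarith
  rcases haX.eq_or_lt with rfl | haX
  · simp only [hw]
    linarith
  have hedge : b ^ 2 = Y ^ 2 → w (a, b) ≤ η := by
    intro hbY2
    have := Real.rpow_le_rpow ha.le haX.le hδ0.le
    rw [hbY2] at hb2
    simp only [hw, hbY2]
    linarith
  rcases hYb.eq_or_lt with rfl | hYb
  · exact hedge (neg_sq Y)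
  rcases hbY.eq_or_lt with rfl | hbY
  · exact hedge rfl
  exfalso
  have hnhds : ContDiffAt ℝ 2 (fun p : ℝ × ℝ => u p.1 p.2) (a, b) :=
    hreg.contDiffAt ((isOpen_lt continuous_const continuous_fst).mem_nhds ha)
  have hfst : ContDiffAt ℝ 2 (fun s => u s b) a :=
    hnhds.comp (f := fun s : ℝ => (s, b)) a (by fun_prop)
  have hsnd : ContDiffAt ℝ 2 (fun s => u a s) b :=
    hnhds.comp (f := fun s : ℝ => (a, s)) b (by fun_prop)
  have h₁ : iteratedDeriv 2 (fun s => u s b) a ≤ 2 * (-2 * κ) := by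
    refine IsLocalMax.iteratedDeriv_two_le (b := A) (c := κ * (b ^ 2 + 2 * X ^ 2)) ?_ hfst
    filter_upwards [Icc_mem_nhds hxa haX] with s hs
    have := hmax (show (s, b) ∈ K from ⟨hs, hYb.le, hbY.le⟩)
    simp only [hw, mem_ofPred_eq] at this
    linarith
  have h₂ : iteratedDeriv 2 (fun s => u a s) b ≤ 2 * κ := by
    refine IsLocalMax.iteratedDeriv_two_le (b := 0)
      (c := A * a + κ * (2 * X ^ 2 - 2 * a ^ 2)) ?_ hsnd
    filter_upwards [Icc_mem_nhds hYb hbY] with s hs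
    have := hmax (show (a, s) ∈ K from ⟨⟨hxa.le, haX.le⟩, hs⟩)
    simp only [hw, mem_ofPred_eq] at this
    linarith
  linarith [hpde a b ha]

/-- A harmonic function on the half-plane bounded above by `x ^ δ`, `0 < δ < 1`, is nonpositive. -/
theorem nonpos_of_harmonic_of_le_rpow
    {δ : ℝ} (hδ0 : 0 < δ) (hδ1 : δ < 1) {u : ℝ → ℝ → ℝ}
    (hreg : ContDiffOn ℝ 2 (fun p : ℝ × ℝ => u p.1 p.2) {p : ℝ × ℝ | 0 < p.1})
    (hpde : ∀ x y : ℝ, 0 < x →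
      iteratedDeriv 2 (fun s => u s y) x + iteratedDeriv 2 (fun s => u x s) y = 0)
    (hbd : ∀ x y : ℝ, 0 < x → u x y ≤ x ^ δ) {x y : ℝ} (hx : 0 < x) :
    u x y ≤ 0 := by
  have hX : ∀ X : ℝ, x < X → u x y ≤ X ^ (δ - 1) * x := by
    intro X hxX
    have ht : Tendsto (fun t : ℝ => X ^ (δ - 1) * x + t * (y ^ 2 + 2 * X ^ 2 - 2 * x ^ 2) + t)
        (𝓝[>] 0) (𝓝 (X ^ (δ - 1) * x)) := by
      refine tendsto_nhdsWithin_of_tendsto_nhds (Continuous.tendsto' ?_ _ _ (by simp))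
      fun_prop
    refine ge_of_tendsto ht ?_
    filter_upwards [self_mem_nhdsWithin] with t htpos
    exact le_strip_barrier_of_harmonic hδ0 hreg hpde hbd hx hxX htpos htpos
  have ht : Tendsto (fun X : ℝ => X ^ (δ - 1) * x) atTop (𝓝 0) := by
    have := (tendsto_rpow_neg_atTop (sub_pos.2 hδ1)).mul_const x
    simpa using this
  exact ge_of_tendsto ht ((eventually_gt_atTop x).mono hX)

/-- A Euclidean-harmonic function on the open half-plane bounded by `x^δ` with `0 < δ < 1`
vanishes identically. -/
theorem stronger_no_harmonic_on_halfspace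
    (δ : ℝ) (hδ0 : 0 < δ) (hδ1 : δ < 1)
    (u : ℝ → ℝ → ℝ)
    (hreg : ContDiffOn ℝ 2 (fun p : ℝ × ℝ => u p.1 p.2) {p : ℝ × ℝ | 0 < p.1})
    (hpde : ∀ x y : ℝ, 0 < x →
      iteratedDeriv 2 (fun s => u s y) x + iteratedDeriv 2 (fun s => u x s) y = 0)
    (hbd : ∀ x y : ℝ, 0 < x → |u x y| ≤ x ^ δ) :
    ∀ x y : ℝ, 0 < x → u x y = 0 := by
  intro x y hx
  refine le_antisymm
    (nonpos_of_harmonic_of_le_rpow hδ0 hδ1 hreg hpde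
      (fun x y hx => (le_abs_self _).trans (hbd x y hx)) hx) ?_
  have hneg : -u x y ≤ 0 := by
    refine nonpos_of_harmonic_of_le_rpow (u := fun x y => -u x y) hδ0 hδ1 hreg.neg ?_
      (fun x y hx => (neg_le_abs _).trans (hbd x y hx)) hx
    intro x y hx
    rw [iteratedDeriv_fun_neg, iteratedDeriv_fun_neg]
    linarith [hpde x y hx]
  linarith
end

section
/- Let c ≥ 0 and let δ be a real number with −√(5+4c)/2 < δ < √(5+4c)/2. Suppose u : {(x,y) ∈ ℝ² : x > 0} → ℂ is twice continuously differentiable, satisfies −x²(∂²u/∂x² + ∂²u/∂y²) + 2·i·x·∂u/∂y + (1 + c)·u = 0 at every point of the half-plane, and satisfies ∫₀^∞ ∫_ℝ x^(−2δ−2) |u(x,y)|² dy dx < ∞. Then u is identically zero. -/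
open MeasureTheory

theorem hasDerivAt_integral_mul_translate {f b : ℝ × ℝ → ℝ} (hf : Continuous f)
    (hfc : HasCompactSupport f) (hb : ContDiff ℝ 1 b) (hbc : HasCompactSupport b) (e : ℝ × ℝ) :
    HasDerivAt (fun h : ℝ => ∫ p, f p * b (p + h • e)) (∫ p, f p * fderiv ℝ b p e) 0 := by
  have hb' : Continuous fun p => fderiv ℝ b p e := (hb.continuous_fderiv one_ne_zero).clm_apply
    continuous_const
  obtain ⟨C, hC⟩ := hb'.bounded_above_of_compact_support
    (hbc.fderiv_apply (𝕜 := ℝ) e)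
  have key := hasDerivAt_integral_of_dominated_loc_of_deriv_le (μ := (volume : Measure (ℝ × ℝ)))
    (F := fun (h : ℝ) p => f p * b (p + h • e)) (x₀ := 0) (s := Set.univ)
    (F' := fun (h : ℝ) p => f p * fderiv ℝ b (p + h • e) e) (bound := fun p => ‖f p‖ * C)
    Filter.univ_mem ?_ ?_ ?_ ?_ ?_ ?_
  · simpa using key.2
  · refine Filter.Eventually.of_forall fun h => Continuous.aestronglyMeasurable ?_
    have := hb.continuous
    fun_prop
  · refine Continuous.integrable_of_hasCompactSupport ?_ hfc.mul_right
    have := hb.continuous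
    fun_prop
  · refine Continuous.aestronglyMeasurable ?_
    simp only [zero_smul, add_zero]
    exact hf.mul hb'
  · refine Filter.Eventually.of_forall fun p h _ => ?_
    rw [norm_mul]
    exact mul_le_mul_of_nonneg_left (hC _) (norm_nonneg _)
  · exact ((hf.norm).integrable_of_hasCompactSupport hfc.norm).mul_const C
  · refine Filter.Eventually.of_forall fun p h _ => ?_
    have h1 : HasDerivAt (fun t : ℝ => p + t • e) e h := by
      simpa using ((hasDerivAt_id h).smul_const e).const_add p
    exact ((hb.differentiable one_ne_zero _).hasFDerivAt.comp_hasDerivAt h h1).const_mul (f p)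

theorem integral_fderiv_mul_fderiv_comm {a b : ℝ × ℝ → ℝ} (ha : ContDiff ℝ 1 a)
    (hac : HasCompactSupport a) (hb : ContDiff ℝ 1 b) (hbc : HasCompactSupport b)
    (d e : ℝ × ℝ) :
    ∫ p, fderiv ℝ a p d * fderiv ℝ b p e = ∫ p, fderiv ℝ a p e * fderiv ℝ b p d := by
  have hcont {g : ℝ × ℝ → ℝ} (hg : ContDiff ℝ 1 g) (w : ℝ × ℝ) :
      Continuous fun p => fderiv ℝ g p w :=
    (hg.continuous_fderiv one_ne_zero).clm_apply continuous_const
  have h1 := hasDerivAt_integral_mul_translate (hcont ha d) (hac.fderiv_apply (𝕜 := ℝ) d) hb hbc e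
  have h2 := hasDerivAt_integral_mul_translate (hcont hb d) (hbc.fderiv_apply (𝕜 := ℝ) d) ha hac e
  have h3 : (fun h : ℝ => ∫ p, fderiv ℝ a p d * b (p + h • e))
      = fun h : ℝ => -∫ p, fderiv ℝ b p d * a (p + (-h) • e) := by
    funext h
    have hbt : ContDiff ℝ 1 fun p => b (p + h • e) := hb.comp (contDiff_id.add contDiff_const)
    have hder (p : ℝ × ℝ) : fderiv ℝ (fun q => b (q + h • e)) p = fderiv ℝ b (p + h • e) :=
      fderiv_comp_add_right _
    have ibp := integral_mul_fderiv_eq_neg_fderiv_mul_of_integrable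
      (μ := (volume : Measure (ℝ × ℝ))) (f := a) (g := fun p => b (p + h • e)) (v := d)
      (((hcont ha d).mul hbt.continuous).integrable_of_hasCompactSupport
        (hac.fderiv_apply (𝕜 := ℝ) d).mul_right)
      ((ha.continuous.mul (hcont hbt d)).integrable_of_hasCompactSupport hac.mul_right)
      ((ha.continuous.mul hbt.continuous).integrable_of_hasCompactSupport hac.mul_right)
      (fun p _ => ha.differentiable one_ne_zero p)
      (fun p _ => hbt.differentiable one_ne_zero p)
    simp only [hder] at ibp
    rw [← neg_eq_iff_eq_neg, ← ibp, ← integral_add_right_eq_self (μ := (volume : Measure (ℝ × ℝ)))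
      (fun p => fderiv ℝ b p d * a (p + (-h) • e)) (h • e)]
    refine integral_congr_ae (Filter.Eventually.of_forall fun p => ?_)
    simp [mul_comm]
  have h4 : HasDerivAt (fun h : ℝ => -∫ p, fderiv ℝ b p d * a (p + (-h) • e))
      (∫ p, fderiv ℝ b p d * fderiv ℝ a p e) 0 := by
    rw [← neg_zero] at h2
    have h5 := (h2.comp 0 (hasDerivAt_neg 0)).neg
    rw [mul_neg_one, neg_neg] at h5
    exact h5
  rw [h3] at h1
  rw [h1.unique h4]
  simp only [mul_comm]

theorem integral_fderiv_apply_eq_zero {G : ℝ × ℝ → ℝ} (hG : ContDiff ℝ 1 G)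
    (hGc : HasCompactSupport G) (e : ℝ × ℝ) : ∫ p, fderiv ℝ G p e = 0 := by
  have hcont : Continuous fun p => fderiv ℝ G p e :=
    (hG.continuous_fderiv one_ne_zero).clm_apply continuous_const
  have := integral_mul_fderiv_eq_neg_fderiv_mul_of_integrable
      (μ := (volume : Measure (ℝ × ℝ))) (f := fun _ => (1 : ℝ)) (g := G) (v := e)
      (by simp)
      (by simpa using hcont.integrable_of_hasCompactSupport (hGc.fderiv_apply (𝕜 := ℝ) e))
      (by simpa using hG.continuous.integrable_of_hasCompactSupport hGc)
      (by simp)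
      (fun p _ => hG.differentiable one_ne_zero p)
  simpa using this

theorem HasCompactSupport.of_eq_zero_of_fderiv_eq_zero {θ : ℝ × ℝ → ℝ} (hθc : HasCompactSupport θ)
    {F : ℝ × ℝ → ℝ} (hF : ∀ p, θ p = 0 → fderiv ℝ θ p = 0 → F p = 0) : HasCompactSupport F := by
  refine HasCompactSupport.intro (K := tsupport θ) hθc fun p hp => hF p ?_ ?_
  · exact image_eq_zero_of_notMem_tsupport hp
  · by_contra h
    exact hp (support_fderiv_subset ℝ h)

/-- The first-order system, in coordinates `(s, y)` with `x = exp s`, equivalent to the twisted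
Laplace equation for `u = u₁ + i u₂`, with `v = v₁ + i v₂ = ∂ₛ u - i eˢ ∂_y u - u`. -/
structure TwistedSystem (l : ℝ) (u₁ u₂ v₁ v₂ : ℝ × ℝ → ℝ) : Prop where
  contDiff_u₁ : ContDiff ℝ 1 u₁
  contDiff_u₂ : ContDiff ℝ 1 u₂
  contDiff_v₁ : ContDiff ℝ 1 v₁
  contDiff_v₂ : ContDiff ℝ 1 v₂
  lower_re : ∀ p, fderiv ℝ u₁ p (1, 0) + Real.exp p.1 * fderiv ℝ u₂ p (0, 1) = u₁ p + v₁ p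
  lower_im : ∀ p, fderiv ℝ u₂ p (1, 0) - Real.exp p.1 * fderiv ℝ u₁ p (0, 1) = u₂ p + v₂ p
  raise_re : ∀ p, fderiv ℝ v₁ p (1, 0) - Real.exp p.1 * fderiv ℝ v₂ p (0, 1) = l * u₁ p
  raise_im : ∀ p, fderiv ℝ v₂ p (1, 0) + Real.exp p.1 * fderiv ℝ v₁ p (0, 1) = l * u₂ p

/-- The squared hyperbolic gradient of `θ`, with `∂ₛ` shifted to `∂ₛ + 1/2`: the weight on `v ^ 2` in
the energy and Caccioppoli estimates. -/
noncomputable def twistedGradSq (θ : ℝ × ℝ → ℝ) (p : ℝ × ℝ) : ℝ :=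
  (fderiv ℝ θ p (1, 0) + θ p / 2) ^ 2 + (Real.exp p.1 * fderiv ℝ θ p (0, 1)) ^ 2

theorem twistedGradSq_eq_zero {θ : ℝ × ℝ → ℝ} {p : ℝ × ℝ} (h0 : θ p = 0)
    (h1 : fderiv ℝ θ p = 0) : twistedGradSq θ p = 0 := by
  simp [twistedGradSq, h0, h1]

theorem ContDiff.continuous_fderiv_const {g : ℝ × ℝ → ℝ} (hg : ContDiff ℝ 1 g) (w : ℝ × ℝ) :
    Continuous fun p => fderiv ℝ g p w :=
  (hg.continuous_fderiv one_ne_zero).clm_apply continuous_const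

theorem continuous_twistedGradSq {θ : ℝ × ℝ → ℝ} (hθ : ContDiff ℝ 1 θ) :
    Continuous (twistedGradSq θ) := by
  have h1 := hθ.continuous_fderiv_const (1, 0)
  have h2 := hθ.continuous_fderiv_const (0, 1)
  have h3 := hθ.continuous
  unfold twistedGradSq
  fun_prop

namespace TwistedSystem

variable {l : ℝ} {u₁ u₂ v₁ v₂ θ : ℝ × ℝ → ℝ}

/-- The integrand of the identity obtained by pairing the system with `θ ^ 2`. -/
noncomputable def crossDensity (u₁ u₂ v₁ v₂ θ : ℝ × ℝ → ℝ) (l : ℝ) (p : ℝ × ℝ) : ℝ :=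
  θ p ^ 2 * (v₁ p ^ 2 + v₂ p ^ 2) + l * (θ p ^ 2 * (u₁ p ^ 2 + u₂ p ^ 2))
    + 2 * θ p * ((fderiv ℝ θ p (1, 0) + θ p / 2) * (v₁ p * u₁ p + v₂ p * u₂ p)
      + Real.exp p.1 * fderiv ℝ θ p (0, 1) * (v₁ p * u₂ p - v₂ p * u₁ p))

theorem integral_crossDensity (h : TwistedSystem l u₁ u₂ v₁ v₂) (hθ : ContDiff ℝ 1 θ)
    (hθc : HasCompactSupport θ) :
    Integrable (crossDensity u₁ u₂ v₁ v₂ θ l) ∧ ∫ p, crossDensity u₁ u₂ v₁ v₂ θ l p = 0 := by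
  obtain ⟨hu1, hu2, hv1, hv2, e1, e2, e3, e4⟩ := h
  have hE : ContDiff ℝ 1 fun p : ℝ × ℝ => Real.exp p.1 := by fun_prop
  set G : ℝ × ℝ → ℝ := fun p => θ p ^ 2 * (v₁ p * u₁ p + v₂ p * u₂ p) with hG
  set K : ℝ × ℝ → ℝ := fun p => Real.exp p.1 * (θ p ^ 2 * (v₁ p * u₂ p - v₂ p * u₁ p)) with hK
  have hGd : ContDiff ℝ 1 G := by fun_prop
  have hKd : ContDiff ℝ 1 K := by fun_prop
  have hGc : HasCompactSupport G :=
      HasCompactSupport.of_eq_zero_of_fderiv_eq_zero hθc fun p h0 _ => by simp [hG, h0]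
  have hKc : HasCompactSupport K :=
      HasCompactSupport.of_eq_zero_of_fderiv_eq_zero hθc fun p h0 _ => by simp [hK, h0]
  have hGi := (hGd.continuous_fderiv_const (1, 0)).integrable_of_hasCompactSupport (μ := volume)
    (hGc.fderiv_apply (𝕜 := ℝ) _)
  have hKi := (hKd.continuous_fderiv_const (0, 1)).integrable_of_hasCompactSupport (μ := volume)
    (hKc.fderiv_apply (𝕜 := ℝ) _)
  have key : crossDensity u₁ u₂ v₁ v₂ θ l =
      fun p => fderiv ℝ G p (1, 0) + fderiv ℝ K p (0, 1) := by
    funext p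
    have dθ := (hθ.differentiable one_ne_zero p).hasFDerivAt
    have du1 := (hu1.differentiable one_ne_zero p).hasFDerivAt
    have du2 := (hu2.differentiable one_ne_zero p).hasFDerivAt
    have dv1 := (hv1.differentiable one_ne_zero p).hasFDerivAt
    have dv2 := (hv2.differentiable one_ne_zero p).hasFDerivAt
    have dE : HasFDerivAt (fun p : ℝ × ℝ => Real.exp p.1) _ p := (hasFDerivAt_fst (𝕜 := ℝ)).exp
    have dG : HasFDerivAt G _ p := (dθ.pow 2).mul ((dv1.mul du1).add (dv2.mul du2))
    have dK : HasFDerivAt K _ p := dE.mul ((dθ.pow 2).mul ((dv1.mul du2).sub (dv2.mul du1)))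
    rw [dG.fderiv, dK.fderiv]
    simp [crossDensity]
    linear_combination (-θ p ^ 2 * v₁ p) * e1 p - (θ p ^ 2 * v₂ p) * e2 p
      - θ p ^ 2 * u₁ p * e3 p - θ p ^ 2 * u₂ p * e4 p
  rw [key]
  refine ⟨hGi.add hKi, ?_⟩
  rw [integral_add hGi hKi, integral_fderiv_apply_eq_zero hGd hGc,
    integral_fderiv_apply_eq_zero hKd hKc, add_zero]

theorem integrable_of_cutoff (hθc : HasCompactSupport θ)
    {F : ℝ × ℝ → ℝ} (hFc : Continuous F)
    (hF : ∀ p, θ p = 0 → fderiv ℝ θ p = 0 → F p = 0) : Integrable F :=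
  hFc.integrable_of_hasCompactSupport (HasCompactSupport.of_eq_zero_of_fderiv_eq_zero hθc hF)

theorem caccioppoli (h : TwistedSystem l u₁ u₂ v₁ v₂) (hl : 0 ≤ l) (hθ : ContDiff ℝ 1 θ)
    (hθc : HasCompactSupport θ) :
    ∫ p, θ p ^ 2 * (v₁ p ^ 2 + v₂ p ^ 2) ≤
      4 * ∫ p, twistedGradSq θ p * (u₁ p ^ 2 + u₂ p ^ 2) := by
  obtain ⟨hi, h0⟩ := h.integral_crossDensity hθ hθc
  have hu1 := h.contDiff_u₁.continuous
  have hu2 := h.contDiff_u₂.continuous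
  have hv1 := h.contDiff_v₁.continuous
  have hv2 := h.contDiff_v₂.continuous
  have hθ' := hθ.continuous
  have hT := continuous_twistedGradSq hθ
  have i1 : Integrable fun p => θ p ^ 2 * (v₁ p ^ 2 + v₂ p ^ 2) :=
    integrable_of_cutoff hθc (by fun_prop) fun p h0 _ => by simp [h0]
  have i2 : Integrable fun p => twistedGradSq θ p * (u₁ p ^ 2 + u₂ p ^ 2) :=
    integrable_of_cutoff hθc (by fun_prop) fun p h0 h1 => by
        rw [twistedGradSq_eq_zero h0 h1, zero_mul]
  have key : ∫ p, θ p ^ 2 * (v₁ p ^ 2 + v₂ p ^ 2) ≤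
      ∫ p, (4 * (twistedGradSq θ p * (u₁ p ^ 2 + u₂ p ^ 2))
        + 2 * crossDensity u₁ u₂ v₁ v₂ θ l p) := by
    refine integral_mono i1 ((i2.const_mul 4).add (hi.const_mul 2)) fun p => ?_
    simp only [twistedGradSq, crossDensity]
    set κ := fderiv ℝ θ p (1, 0) + θ p / 2
    set τ := Real.exp p.1 * fderiv ℝ θ p (0, 1)
    have : 0 ≤ l * (θ p ^ 2 * (u₁ p ^ 2 + u₂ p ^ 2)) := by positivity
    nlinarith [sq_nonneg (θ p * v₁ p + 2 * (κ * u₁ p + τ * u₂ p)),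
      sq_nonneg (θ p * v₂ p + 2 * (κ * u₂ p - τ * u₁ p))]
  rwa [integral_add (i2.const_mul 4) (hi.const_mul 2), integral_const_mul, integral_const_mul, h0,
    mul_zero, add_zero] at key

theorem energy (h : TwistedSystem l u₁ u₂ v₁ v₂) (hθ : ContDiff ℝ 1 θ)
    (hθc : HasCompactSupport θ) :
    (1 / 4 + l) * ∫ p, θ p ^ 2 * (v₁ p ^ 2 + v₂ p ^ 2) ≤
      ∫ p, twistedGradSq θ p * (v₁ p ^ 2 + v₂ p ^ 2) := by
  obtain ⟨hi, h0⟩ := h.integral_crossDensity hθ hθc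
  have hv1d := h.contDiff_v₁
  have hv2d := h.contDiff_v₂
  have hv1 := h.contDiff_v₁.continuous
  have hv2 := h.contDiff_v₂.continuous
  have hθ' := hθ.continuous
  have hT := continuous_twistedGradSq hθ
  have i1 : Integrable fun p => θ p ^ 2 * (v₁ p ^ 2 + v₂ p ^ 2) :=
    integrable_of_cutoff hθc (by fun_prop) fun p h0 _ => by simp [h0]
  have i2 : Integrable fun p => twistedGradSq θ p * (v₁ p ^ 2 + v₂ p ^ 2) :=
    integrable_of_cutoff hθc (by fun_prop) fun p h0 h1 => by
        rw [twistedGradSq_eq_zero h0 h1, zero_mul]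
  set H : ℝ × ℝ → ℝ := fun p => θ p ^ 2 * (v₁ p ^ 2 + v₂ p ^ 2) with hH
  have hHd : ContDiff ℝ 1 H := by fun_prop
  have hHc : HasCompactSupport H :=
      HasCompactSupport.of_eq_zero_of_fderiv_eq_zero hθc fun p h0 _ => by simp [hH, h0]
  set f₁ : ℝ × ℝ → ℝ := fun p => Real.exp (p.1 / 2) * (θ p * v₁ p) with hf₁
  set f₂ : ℝ × ℝ → ℝ := fun p => Real.exp (p.1 / 2) * (θ p * v₂ p) with hf₂
  have hf1 : ContDiff ℝ 1 f₁ := by fun_prop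
  have hf2 : ContDiff ℝ 1 f₂ := by fun_prop
  have hf1c : HasCompactSupport f₁ :=
    
      HasCompactSupport.of_eq_zero_of_fderiv_eq_zero hθc fun p h0 _ => by simp [hf₁, h0]
  have hf2c : HasCompactSupport f₂ :=
    
      HasCompactSupport.of_eq_zero_of_fderiv_eq_zero hθc fun p h0 _ => by simp [hf₂, h0]
  have iH := (hHd.continuous_fderiv_const (1, 0)).integrable_of_hasCompactSupport (μ := volume)
    (hHc.fderiv_apply (𝕜 := ℝ) _)
  have iA : Integrable fun p => fderiv ℝ f₁ p (1, 0) * fderiv ℝ f₂ p (0, 1) :=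
    ((hf1.continuous_fderiv_const _).mul
      (hf2.continuous_fderiv_const _)).integrable_of_hasCompactSupport
      (hf1c.fderiv_apply (𝕜 := ℝ) _).mul_right
  have iB : Integrable fun p => fderiv ℝ f₁ p (0, 1) * fderiv ℝ f₂ p (1, 0) :=
    ((hf1.continuous_fderiv_const _).mul
      (hf2.continuous_fderiv_const _)).integrable_of_hasCompactSupport
      (hf1c.fderiv_apply (𝕜 := ℝ) _).mul_right
  have hH0 := integral_fderiv_apply_eq_zero hHd hHc (1, 0)
  have hAB := integral_fderiv_mul_fderiv_comm hf1 hf1c hf2 hf2c (1, 0) (0, 1)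
  have key : 0 ≤ ∫ p, ((twistedGradSq θ p * (v₁ p ^ 2 + v₂ p ^ 2) - (1 / 4 + l) * H p)
      + (l * crossDensity u₁ u₂ v₁ v₂ θ l p - 1 / 2 * fderiv ℝ H p (1, 0)))
      + 2 * (fderiv ℝ f₁ p (1, 0) * fderiv ℝ f₂ p (0, 1)
        - fderiv ℝ f₁ p (0, 1) * fderiv ℝ f₂ p (1, 0)) := by
    refine integral_nonneg fun p => ?_
    have dθ := (hθ.differentiable one_ne_zero p).hasFDerivAt
    have dv1 := (hv1d.differentiable one_ne_zero p).hasFDerivAt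
    have dv2 := (hv2d.differentiable one_ne_zero p).hasFDerivAt
    have dE : HasFDerivAt (fun p : ℝ × ℝ => Real.exp (p.1 / 2)) _ p :=
      ((hasFDerivAt_fst (𝕜 := ℝ)).mul_const (2⁻¹ : ℝ)).exp
    have dH : HasFDerivAt H _ p := (dθ.pow 2).mul ((dv1.pow 2).add (dv2.pow 2))
    have df1 : HasFDerivAt f₁ _ p := dE.mul (dθ.mul dv1)
    have df2 : HasFDerivAt f₂ _ p := dE.mul (dθ.mul dv2)
    have hexp : Real.exp p.1 = Real.exp (p.1 / 2) ^ 2 := by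
      rw [← Real.exp_nat_mul]; congr 1; push_cast; ring
    have e3 := h.raise_re p
    have e4 := h.raise_im p
    rw [dH.fderiv, df1.fderiv, df2.fderiv]
    simp [crossDensity, twistedGradSq, hH, ← div_eq_mul_inv]
    rw [hexp] at e3 e4 ⊢
    set E := Real.exp (p.1 / 2)
    set a := fderiv ℝ θ p (1, 0)
    set b := fderiv ℝ θ p (0, 1)
    set c1 := fderiv ℝ v₁ p (1, 0)
    set c2 := fderiv ℝ v₂ p (1, 0)
    set d1 := fderiv ℝ v₁ p (0, 1)
    set d2 := fderiv ℝ v₂ p (0, 1)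
    have := add_nonneg (add_nonneg (sq_nonneg (a * v₁ p + θ p * c1))
      (sq_nonneg (a * v₂ p + θ p * c2))) (add_nonneg (sq_nonneg (E ^ 2 * (b * v₁ p + θ p * d1)))
      (sq_nonneg (E ^ 2 * (b * v₂ p + θ p * d2))))
    refine this.trans (le_of_eq ?_)
    have e3' : c1 = l * u₁ p + E ^ 2 * d2 := by linarith
    have e4' : c2 = l * u₂ p - E ^ 2 * d1 := by linarith
    rw [e3', e4']
    ring
  have iT : Integrable fun p => twistedGradSq θ p * (v₁ p ^ 2 + v₂ p ^ 2) - (1 / 4 + l) * H p :=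
    i2.sub (i1.const_mul (1 / 4 + l))
  have iS : Integrable fun p => l * crossDensity u₁ u₂ v₁ v₂ θ l p
      - 1 / 2 * fderiv ℝ H p (1, 0) := (hi.const_mul l).sub (iH.const_mul (1 / 2))
  have iAB : Integrable fun p => 2 * (fderiv ℝ f₁ p (1, 0) * fderiv ℝ f₂ p (0, 1)
      - fderiv ℝ f₁ p (0, 1) * fderiv ℝ f₂ p (1, 0)) := (iA.sub iB).const_mul 2
  have iTS : Integrable fun p => (twistedGradSq θ p * (v₁ p ^ 2 + v₂ p ^ 2) - (1 / 4 + l) * H p)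
      + (l * crossDensity u₁ u₂ v₁ v₂ θ l p - 1 / 2 * fderiv ℝ H p (1, 0)) := iT.add iS
  rw [integral_add iTS iAB, integral_add iT iS,
    integral_sub i2 (i1.const_mul _), integral_sub (hi.const_mul l) (iH.const_mul _),
    integral_const_mul, integral_const_mul, integral_const_mul, integral_const_mul,
    integral_sub iA iB, h0, hH0, hAB] at key
  linarith

end TwistedSystem

theorem exists_contDiff_cutoff : ∃ a : ℝ → ℝ, ContDiff ℝ 1 a ∧ (∀ t, 0 ≤ a t) ∧ (∀ t, a t ≤ 1) ∧
    (∀ t, |t| ≤ 1 → a t = 1) ∧ (∀ t, 2 ≤ |t| → a t = 0) ∧ ∃ M, ∀ t, |deriv a t| ≤ M := by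
  let b : ContDiffBump (0 : ℝ) := ⟨1, 2, one_pos, one_lt_two⟩
  have hb : ContDiff ℝ 1 b := b.contDiff
  refine ⟨b, hb, fun t => b.nonneg, fun t => b.le_one, fun t ht => ?_, fun t ht => ?_, ?_⟩
  · exact b.one_of_mem_closedBall (by simpa [b] using ht)
  · exact b.zero_of_le_dist (by simpa [b] using ht)
  · exact (hb.continuous_deriv le_rfl).bounded_above_of_compact_support b.hasCompactSupport.deriv

/-- A compactly supported `C¹` function with values in `[0, 1]` and gradient of size `ε`. -/
structure IsCutoff (χ : ℝ × ℝ → ℝ) (ε : ℝ) : Prop where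
  contDiff : ContDiff ℝ 1 χ
  hasCompactSupport : HasCompactSupport χ
  nonneg : ∀ p, 0 ≤ χ p
  le_one : ∀ p, χ p ≤ 1
  abs_fderiv_fst_le : ∀ p, |fderiv ℝ χ p (1, 0)| ≤ ε
  abs_fderiv_snd_le : ∀ p, |Real.exp p.1 * fderiv ℝ χ p (0, 1)| ≤ ε

theorem exists_isCutoff_exhaustion : ∃ M : ℝ, 0 ≤ M ∧ ∃ χ : ℕ → ℝ × ℝ → ℝ,
    (∀ n, 1 ≤ n → IsCutoff (χ n) (M / n)) ∧ (∀ p, ∃ N, 1 ≤ N ∧ χ N p = 1) ∧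
    ∀ N n, 1 ≤ N → 2 * N ≤ n → ∀ q, χ N q ≠ 0 → χ n q = 1 := by
  obtain ⟨a, ha, ha0, ha1, hone, hzero, M, hM⟩ := exists_contDiff_cutoff
  have hM0 : 0 ≤ M := (abs_nonneg _).trans (hM 0)
  refine ⟨M, hM0, fun n p => a (p.1 / n) * a (p.2 * (Real.exp (-(2 * n)) / n)), ?_, ?_, ?_⟩
  · intro n hn
    have hn0 : (0 : ℝ) < n := by exact_mod_cast hn
    set r : ℝ := Real.exp (-(2 * n)) / n with hr
    have hr0 : 0 < r := by positivity
    have hfd (p : ℝ × ℝ) : HasFDerivAt (fun p : ℝ × ℝ => a (p.1 / n) * a (p.2 * r))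
        (a (p.1 / n) • (deriv a (p.2 * r) • r • ContinuousLinearMap.snd ℝ ℝ ℝ)
          + a (p.2 * r) • (deriv a (p.1 / n) • (n : ℝ)⁻¹ • ContinuousLinearMap.fst ℝ ℝ ℝ)) p := by
      have d1 : HasFDerivAt (fun p : ℝ × ℝ => a (p.1 / n)) _ p :=
        ((ha.differentiable one_ne_zero _).hasDerivAt).comp_hasFDerivAt p
          ((hasFDerivAt_fst (𝕜 := ℝ)).mul_const (n : ℝ)⁻¹)
      have d2 : HasFDerivAt (fun p : ℝ × ℝ => a (p.2 * r)) _ p :=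
        ((ha.differentiable one_ne_zero _).hasDerivAt).comp_hasFDerivAt p
          ((hasFDerivAt_snd (𝕜 := ℝ)).mul_const r)
      exact d1.mul d2
    refine ⟨by fun_prop, ?_, fun p => mul_nonneg (ha0 _) (ha0 _),
      fun p => mul_le_one₀ (ha1 _) (ha0 _) (ha1 _), fun p => ?_, fun p => ?_⟩
    · refine HasCompactSupport.intro (K := Set.Icc (-(2 * n : ℝ)) (2 * n) ×ˢ
        Set.Icc (-(2 / r)) (2 / r))
        (isCompact_Icc.prod isCompact_Icc) fun p hp => ?_
      by_contra hne
      have h1 : |p.1 / n| < 2 := by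
        by_contra! h
        exact hne (by simp only [hzero _ h, zero_mul])
      have h2 : |p.2 * r| < 2 := by
        by_contra! h
        exact hne (by simp only [← hr, hzero _ h, mul_zero])
      rw [abs_div, abs_of_pos hn0, div_lt_iff₀ hn0] at h1
      rw [abs_mul, abs_of_pos hr0, ← lt_div_iff₀ hr0] at h2
      exact hp ⟨abs_le.mp h1.le, abs_le.mp h2.le⟩
    · rw [(hfd p).fderiv]
      simp only [add_apply, smul_apply,
        ContinuousLinearMap.coe_fst', ContinuousLinearMap.coe_snd', smul_eq_mul, mul_zero,
        zero_add, mul_one]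
      rw [abs_mul, abs_mul, abs_of_nonneg (ha0 _), abs_of_pos (inv_pos.mpr hn0), ← div_eq_mul_inv]
      calc a (p.2 * r) * (|deriv a (p.1 / n)| / n) ≤ 1 * (M / n) := by
            gcongr
            · exact ha1 _
            · exact hM _
        _ = M / n := one_mul _
    · rw [(hfd p).fderiv]
      simp only [add_apply, smul_apply,
        ContinuousLinearMap.coe_fst', ContinuousLinearMap.coe_snd', smul_eq_mul, mul_zero,
        add_zero, mul_one]
      by_cases hp : 2 ≤ |p.1 / n|
      · rw [hzero _ hp]
        simp only [zero_mul, mul_zero, abs_zero]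
        positivity
      · rw [not_le, abs_div, abs_of_pos hn0, div_lt_iff₀ hn0] at hp
        have hexp : Real.exp p.1 * r ≤ 1 / n := by
          rw [hr, ← mul_div_assoc, ← Real.exp_add]
          gcongr
          rw [Real.exp_le_one_iff]
          linarith [le_abs_self p.1]
        rw [abs_mul, abs_mul, abs_mul, abs_of_nonneg (ha0 _), abs_of_pos hr0,
          abs_of_pos (Real.exp_pos _)]
        calc Real.exp p.1 * (a (p.1 / n) * (|deriv a (p.2 * r)| * r))
            = a (p.1 / n) * (|deriv a (p.2 * r)| * (Real.exp p.1 * r)) := by ring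
          _ ≤ 1 * (M * (1 / n)) := by
            gcongr
            · exact ha1 _
            · exact hM _
          _ = M / n := by ring
  · intro p
    obtain ⟨N, hN⟩ := exists_nat_ge (max 1 (max |p.1| |p.2|))
    have h1 : (1 : ℝ) ≤ N := (le_max_left _ _).trans hN
    have h2 : |p.1| ≤ N := ((le_max_left _ _).trans (le_max_right _ _)).trans hN
    have h3 : |p.2| ≤ N := ((le_max_right _ _).trans (le_max_right _ _)).trans hN
    have hN0 : (0 : ℝ) < N := by linarith
    refine ⟨N, by exact_mod_cast h1, ?_⟩
    dsimp only
    rw [hone, hone, one_mul]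
    · rw [abs_mul, abs_of_pos (show 0 < Real.exp (-(2 * (N : ℝ))) / N by positivity),
        ← mul_div_assoc, div_le_one hN0]
      have : Real.exp (-(2 * (N : ℝ))) ≤ 1 := Real.exp_le_one_iff.mpr (by linarith)
      nlinarith [abs_nonneg p.2]
    · rw [abs_div, abs_of_pos hN0, div_le_one hN0]
      exact h2
  · intro N n hN hn q hq
    have hN0 : (0 : ℝ) < N := by exact_mod_cast hN
    have hn' : 2 * (N : ℝ) ≤ n := by exact_mod_cast hn
    have hn0 : (0 : ℝ) < n := by linarith
    have h1 : |q.1 / N| < 2 := by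
      by_contra! h
      exact hq (by simp only [hzero _ h, zero_mul])
    have h2 : |q.2 * (Real.exp (-(2 * N)) / N)| < 2 := by
      by_contra! h
      exact hq (by simp only [hzero _ h, mul_zero])
    rw [abs_div, abs_of_pos hN0, div_lt_iff₀ hN0] at h1
    rw [abs_mul, abs_of_pos (show 0 < Real.exp (-(2 * (N : ℝ))) / N by positivity),
      ← mul_div_assoc, div_lt_iff₀ hN0] at h2
    dsimp only
    rw [hone, hone, one_mul]
    · rw [abs_mul, abs_of_pos (show 0 < Real.exp (-(2 * (n : ℝ))) / n by positivity),
        ← mul_div_assoc, div_le_one hn0]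
      have : Real.exp (-(2 * (n : ℝ))) ≤ Real.exp (-(2 * (N : ℝ))) :=
        Real.exp_le_exp.mpr (by linarith)
      nlinarith [abs_nonneg q.2]
    · rw [abs_div, abs_of_pos hn0, div_le_one hn0]
      linarith

theorem twistedGradSq_exp_mul {χ : ℝ × ℝ → ℝ} (hχ : ContDiff ℝ 1 χ) (δ : ℝ) (p : ℝ × ℝ) :
    twistedGradSq (fun p => Real.exp (-(δ + 1 / 2) * p.1) * χ p) p =
      Real.exp (-(δ + 1 / 2) * p.1) ^ 2 * ((fderiv ℝ χ p (1, 0) - δ * χ p) ^ 2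
        + (Real.exp p.1 * fderiv ℝ χ p (0, 1)) ^ 2) := by
  have dχ := (hχ.differentiable one_ne_zero p).hasFDerivAt
  have dω : HasFDerivAt (fun p : ℝ × ℝ => Real.exp (-(δ + 1 / 2) * p.1)) _ p :=
    ((hasFDerivAt_fst (𝕜 := ℝ)).const_mul (-(δ + 1 / 2))).exp
  have d : HasFDerivAt (fun p => Real.exp (-(δ + 1 / 2) * p.1) * χ p) _ p := dω.mul dχ
  rw [twistedGradSq, d.fderiv]
  simp
  ring

namespace TwistedSystem

variable {l δ : ℝ} {u₁ u₂ v₁ v₂ : ℝ × ℝ → ℝ}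

theorem integral_cutoff_pow_four_le (h : TwistedSystem l u₁ u₂ v₁ v₂) (hl : 0 ≤ l)
    (hint : Integrable fun p : ℝ × ℝ =>
      Real.exp (-(δ + 1 / 2) * p.1) ^ 2 * (u₁ p ^ 2 + u₂ p ^ 2))
    {M : ℝ} (hM : 0 ≤ M) {n : ℕ} (hn : 1 ≤ n) {χ : ℝ × ℝ → ℝ} (hχ : IsCutoff χ (M / n)) :
    (1 / 4 + l - δ ^ 2) * ∫ p, Real.exp (-(δ + 1 / 2) * p.1) ^ 2 * χ p ^ 4 * (v₁ p ^ 2 + v₂ p ^ 2) ≤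
      (4 * |δ| * M + 8 * M ^ 2) * (4 * (((M + |δ|) ^ 2 + M ^ 2) *
        ∫ p, Real.exp (-(δ + 1 / 2) * p.1) ^ 2 * (u₁ p ^ 2 + u₂ p ^ 2))) / n := by
  obtain ⟨hd, hc, h0, h1, hs, hy⟩ := hχ
  have hn1 : (1 : ℝ) ≤ n := by exact_mod_cast hn
  have hε : M / n ≤ M := div_le_self hM hn1
  have hε0 : 0 ≤ M / n := by positivity
  have hδ := abs_nonneg δ
  have hu1 := h.contDiff_u₁.continuous
  have hu2 := h.contDiff_u₂.continuous
  have hv1 := h.contDiff_v₁.continuous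
  have hv2 := h.contDiff_v₂.continuous
  have hχ' := hd.continuous
  have hsq : ContDiff ℝ 1 fun p => χ p ^ 2 := hd.pow 2
  have hθ1 : ContDiff ℝ 1 fun p : ℝ × ℝ => Real.exp (-(δ + 1 / 2) * p.1) * χ p := by fun_prop
  have hθ2 : ContDiff ℝ 1 fun p : ℝ × ℝ => Real.exp (-(δ + 1 / 2) * p.1) * χ p ^ 2 := by fun_prop
  have hθ1c : HasCompactSupport fun p : ℝ × ℝ => Real.exp (-(δ + 1 / 2) * p.1) * χ p := hc.mul_left
  have hθ2c : HasCompactSupport fun p : ℝ × ℝ => Real.exp (-(δ + 1 / 2) * p.1) * χ p ^ 2 :=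
    HasCompactSupport.mul_left (hc.comp_left (g := fun t => t ^ 2) (by simp))
  have hT1 := continuous_twistedGradSq hθ1
  have hT2 := continuous_twistedGradSq hθ2
  have caccio := h.caccioppoli hl hθ1 hθ1c
  have en := h.energy hθ2 hθ2c
  have hder (p w : ℝ × ℝ) : fderiv ℝ (fun p => χ p ^ 2) p w = 2 * χ p * fderiv ℝ χ p w := by
    rw [((hd.differentiable one_ne_zero p).hasFDerivAt.pow 2).fderiv]
    simp
  have i1 : Integrable fun p : ℝ × ℝ =>
      Real.exp (-(δ + 1 / 2) * p.1) ^ 2 * χ p ^ 2 * (v₁ p ^ 2 + v₂ p ^ 2) :=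
    integrable_of_cutoff hc (by fun_prop) fun p h0 _ => by simp [h0]
  have i2 : Integrable fun p : ℝ × ℝ =>
      Real.exp (-(δ + 1 / 2) * p.1) ^ 2 * χ p ^ 4 * (v₁ p ^ 2 + v₂ p ^ 2) :=
    integrable_of_cutoff hc (by fun_prop) fun p h0 _ => by simp [h0]
  have step1 : ∫ p, Real.exp (-(δ + 1 / 2) * p.1) ^ 2 * χ p ^ 2 * (v₁ p ^ 2 + v₂ p ^ 2) ≤
      4 * (((M + |δ|) ^ 2 + M ^ 2) *
        ∫ p, Real.exp (-(δ + 1 / 2) * p.1) ^ 2 * (u₁ p ^ 2 + u₂ p ^ 2)) := by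
    simp only [mul_pow] at caccio
    refine caccio.trans ?_
    rw [← integral_const_mul ((M + |δ|) ^ 2 + M ^ 2)]
    refine mul_le_mul_of_nonneg_left (integral_mono ?_ (hint.const_mul _) fun p => ?_) (by norm_num)
    · exact integrable_of_cutoff hθ1c (by fun_prop) fun p h0 h1 => by
        rw [twistedGradSq_eq_zero h0 h1, zero_mul]
    · dsimp only
      rw [twistedGradSq_exp_mul hd, mul_comm (Real.exp _ ^ 2), mul_assoc]
      refine mul_le_mul_of_nonneg_right (add_le_add ?_ ?_) (by positivity)
      · refine sq_le_sq' ?_ ?_ <;>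
        · have a1 := abs_le.mp ((hs p).trans hε)
          have a2 : |δ * χ p| ≤ |δ| := by
            rw [abs_mul, abs_of_nonneg (h0 p)]
            exact mul_le_of_le_one_right hδ (h1 p)
          have a3 := abs_le.mp a2
          linarith
      · exact sq_le_sq' (abs_le.mp ((hy p).trans hε)).1 (abs_le.mp ((hy p).trans hε)).2
  have step2 : ∫ p, twistedGradSq (fun p => Real.exp (-(δ + 1 / 2) * p.1) * χ p ^ 2) p
        * (v₁ p ^ 2 + v₂ p ^ 2) ≤
      δ ^ 2 * (∫ p, Real.exp (-(δ + 1 / 2) * p.1) ^ 2 * χ p ^ 4 * (v₁ p ^ 2 + v₂ p ^ 2))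
      + (4 * |δ| * M + 8 * M ^ 2) / n *
        ∫ p, Real.exp (-(δ + 1 / 2) * p.1) ^ 2 * χ p ^ 2 * (v₁ p ^ 2 + v₂ p ^ 2) := by
    rw [← integral_const_mul, ← integral_const_mul,
      ← integral_add (i2.const_mul _) (i1.const_mul _)]
    refine integral_mono ?_ ((i2.const_mul _).add (i1.const_mul _)) fun p => ?_
    · exact integrable_of_cutoff hθ2c (by fun_prop) fun p h0 h1 => by
        rw [twistedGradSq_eq_zero h0 h1, zero_mul]
    · dsimp only
      rw [twistedGradSq_exp_mul hsq, hder, hder]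
      have hs' := hs p
      have hy' := hy p
      have h0' := h0 p
      have h1' := h1 p
      set x := χ p
      set a := fderiv ℝ χ p (1, 0)
      set b := Real.exp p.1 * fderiv ℝ χ p (0, 1) with hb
      have hbd : (2 * x * a - δ * x ^ 2) ^ 2 + (2 * x * b) ^ 2 ≤
          δ ^ 2 * x ^ 4 + (4 * |δ| * M + 8 * M ^ 2) / n * x ^ 2 := by
        have ha2 : a ^ 2 ≤ M * (M / n) := by
          rw [← sq_abs]; nlinarith [abs_nonneg a]
        have hb2 : b ^ 2 ≤ M * (M / n) := by
          rw [← sq_abs]; nlinarith [abs_nonneg b]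
        have hx : -(δ * x * a) ≤ |δ| * (M / n) := by
          refine (neg_le_abs _).trans ?_
          rw [abs_mul, abs_mul, abs_of_nonneg h0']
          exact mul_le_mul (mul_le_of_le_one_right hδ h1') hs' (abs_nonneg _) hδ
        have hsum : 4 * (-(δ * x * a)) + 4 * a ^ 2 + 4 * b ^ 2 ≤
            (4 * |δ| * M + 8 * M ^ 2) / n := by
          have : (4 * |δ| * M + 8 * M ^ 2) / n = 4 * (|δ| * (M / n)) + 8 * (M * (M / n)) := by ring
          linarith
        nlinarith [mul_le_mul_of_nonneg_left hsum (sq_nonneg x)]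
      have hw : 0 ≤ Real.exp (-(δ + 1 / 2) * p.1) ^ 2 * (v₁ p ^ 2 + v₂ p ^ 2) := by positivity
      have := mul_le_mul_of_nonneg_left hbd hw
      calc _ = Real.exp (-(δ + 1 / 2) * p.1) ^ 2 * (v₁ p ^ 2 + v₂ p ^ 2) *
              ((2 * x * a - δ * x ^ 2) ^ 2 + (2 * x * b) ^ 2) := by rw [hb]; ring
        _ ≤ _ := this
        _ = _ := by ring
  simp only [mul_pow, ← pow_mul] at en
  have hK : 0 ≤ (4 * |δ| * M + 8 * M ^ 2) / n := by positivity
  have := mul_le_mul_of_nonneg_left step1 hK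
  rw [sub_mul, mul_div_right_comm]
  linarith

theorem eq_zero (h : TwistedSystem l u₁ u₂ v₁ v₂) (hl : 0 < l) (hδ : δ ^ 2 < 1 / 4 + l)
    (hint : Integrable fun p : ℝ × ℝ =>
      Real.exp (-(δ + 1 / 2) * p.1) ^ 2 * (u₁ p ^ 2 + u₂ p ^ 2)) (p : ℝ × ℝ) :
    u₁ p = 0 ∧ u₂ p = 0 := by
  obtain ⟨M, hM, χ, hχ, hone, hmono⟩ := exists_isCutoff_exhaustion
  have hv1 := h.contDiff_v₁.continuous
  have hv2 := h.contDiff_v₂.continuous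
  set J : ℕ → ℝ × ℝ → ℝ := fun n p =>
    Real.exp (-(δ + 1 / 2) * p.1) ^ 2 * χ n p ^ 4 * (v₁ p ^ 2 + v₂ p ^ 2) with hJ
  have hJc (n : ℕ) (hn : 1 ≤ n) : Continuous (J n) := by
    have := (hχ n hn).contDiff.continuous
    fun_prop
  have hJs (n : ℕ) (hn : 1 ≤ n) : HasCompactSupport (J n) :=
    HasCompactSupport.of_eq_zero_of_fderiv_eq_zero (hχ n hn).hasCompactSupport
      fun p h0 _ => by simp [hJ, h0]
  have hJi (n : ℕ) (hn : 1 ≤ n) : Integrable (J n) :=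
    (hJc n hn).integrable_of_hasCompactSupport (hJs n hn)
  have hJ0 (n : ℕ) (p : ℝ × ℝ) : 0 ≤ J n p := by positivity
  have hv (p : ℝ × ℝ) : v₁ p ^ 2 + v₂ p ^ 2 = 0 := by
    by_contra hne
    obtain ⟨N, hN, hNp⟩ := hone p
    have hpos : 0 < ∫ q, J N q := by
      refine (hJc N hN).integral_pos_of_hasCompactSupport_nonneg_nonzero (hJs N hN) (hJ0 N)
        (x := p) ?_
      simp only [hJ, hNp, one_pow, mul_one]
      exact mul_ne_zero (by positivity) hne
    set D := (4 * |δ| * M + 8 * M ^ 2) * (4 * (((M + |δ|) ^ 2 + M ^ 2) *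
        ∫ p, Real.exp (-(δ + 1 / 2) * p.1) ^ 2 * (u₁ p ^ 2 + u₂ p ^ 2)))
    have hle (n : ℕ) (hn : 2 * N ≤ n) : (1 / 4 + l - δ ^ 2) * ∫ q, J N q ≤ D / n := by
      have hn1 : 1 ≤ n := by omega
      refine le_trans (mul_le_mul_of_nonneg_left ?_ (by linarith))
        (h.integral_cutoff_pow_four_le hl.le hint hM hn1 (hχ n hn1))
      refine integral_mono (hJi N hN) (hJi n hn1) fun q => ?_
      by_cases hq : χ N q = 0
      · exact le_of_eq_of_le (by simp [hJ, hq]) (hJ0 n q)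
      · simp only [hJ, hmono N n hN hn q hq]
        gcongr
        · exact (hχ N hN).nonneg q
        · exact (hχ N hN).le_one q
    have hlim := ge_of_tendsto (tendsto_const_div_atTop_nhds_zero_nat D)
      (Filter.eventually_atTop.mpr ⟨2 * N, hle⟩)
    nlinarith [mul_pos (sub_pos.mpr hδ) hpos]
  have hv1z : v₁ = fun _ => 0 := by funext q; nlinarith [hv q, sq_nonneg (v₁ q), sq_nonneg (v₂ q)]
  have hv2z : v₂ = fun _ => 0 := by funext q; nlinarith [hv q, sq_nonneg (v₁ q), sq_nonneg (v₂ q)]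
  have e3 := h.raise_re p
  have e4 := h.raise_im p
  simp only [hv1z, hv2z, fderiv_fun_const, Pi.zero_apply, zero_apply, mul_zero, sub_zero, add_zero,
    zero_eq_mul, hl.ne', false_or] at e3 e4
  exact ⟨e3, e4⟩

end TwistedSystem

theorem fderiv_apply_fst {F : Type*} [NormedAddCommGroup F] [NormedSpace ℝ F] {g : ℝ × ℝ → F}
    {p : ℝ × ℝ} (hg : DifferentiableAt ℝ g p) :
    fderiv ℝ g p (1, 0) = deriv (fun s => g (s, p.2)) p.1 :=
  (hg.hasFDerivAt.comp_hasDerivAt p.1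
    ((hasDerivAt_id p.1).prodMk (hasDerivAt_const p.1 p.2))).deriv.symm

theorem fderiv_apply_snd {F : Type*} [NormedAddCommGroup F] [NormedSpace ℝ F] {g : ℝ × ℝ → F}
    {p : ℝ × ℝ} (hg : DifferentiableAt ℝ g p) :
    fderiv ℝ g p (0, 1) = deriv (fun t => g (p.1, t)) p.2 :=
  (hg.hasFDerivAt.comp_hasDerivAt p.2
    ((hasDerivAt_const p.2 p.1).prodMk (hasDerivAt_id p.2))).deriv.symm

theorem fderiv_re_apply {g : ℝ × ℝ → ℂ} {p : ℝ × ℝ} (hg : DifferentiableAt ℝ g p) (w : ℝ × ℝ) :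
    fderiv ℝ (fun q => (g q).re) p w = (fderiv ℝ g p w).re := by
  have h : HasFDerivAt (fun q => (g q).re) (Complex.reCLM.comp (fderiv ℝ g p)) p :=
    Complex.reCLM.hasFDerivAt.comp p hg.hasFDerivAt
  rw [h.fderiv]
  rfl

theorem fderiv_im_apply {g : ℝ × ℝ → ℂ} {p : ℝ × ℝ} (hg : DifferentiableAt ℝ g p) (w : ℝ × ℝ) :
    fderiv ℝ (fun q => (g q).im) p w = (fderiv ℝ g p w).im := by
  have h : HasFDerivAt (fun q => (g q).im) (Complex.imCLM.comp (fderiv ℝ g p)) p :=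
    Complex.imCLM.hasFDerivAt.comp p hg.hasFDerivAt
  rw [h.fderiv]
  rfl

theorem ContDiff.fderiv_apply_const {F : Type*} [NormedAddCommGroup F] [NormedSpace ℝ F]
    {g : ℝ × ℝ → F} (hg : ContDiff ℝ 2 g) (w : ℝ × ℝ) :
    ContDiff ℝ 1 fun p => fderiv ℝ g p w :=
  (hg.fderiv_right (m := 1) (by norm_num [one_add_one_eq_two])).clm_apply contDiff_const

theorem ContDiff.fderiv_fderiv_comm {F : Type*} [NormedAddCommGroup F] [NormedSpace ℝ F]
    {g : ℝ × ℝ → F} (hg : ContDiff ℝ 2 g) (p v w : ℝ × ℝ) :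
    fderiv ℝ (fun q => fderiv ℝ g q v) p w = fderiv ℝ (fun q => fderiv ℝ g q w) p v := by
  have hd : DifferentiableAt ℝ (fderiv ℝ g) p :=
    (hg.fderiv_right (m := 1) (by norm_num [one_add_one_eq_two])).differentiable one_ne_zero p
  have hsymm : IsSymmSndFDerivAt ℝ g p := hg.contDiffAt.isSymmSndFDerivAt (by simp)
  have hval (v w : ℝ × ℝ) :
      fderiv ℝ (fun q => fderiv ℝ g q v) p w = fderiv ℝ (fderiv ℝ g) p w v := by
    have h := (hd.hasFDerivAt.clm_apply (hasFDerivAt_const v p)).fderiv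
    rw [h]
    simp
  rw [hval, hval, hsymm.eq]

theorem det_smul_fst_prod_snd (a : ℝ) :
    ((a • ContinuousLinearMap.fst ℝ ℝ ℝ).prod (ContinuousLinearMap.snd ℝ ℝ ℝ)).det = a := by
  rw [ContinuousLinearMap.det, ← LinearMap.det_toMatrix (Module.Basis.finTwoProd ℝ),
    Matrix.det_fin_two]
  simp [LinearMap.toMatrix_apply]

theorem integrable_comp_exp_fst {g : ℝ × ℝ → ℝ}
    (hg : IntegrableOn g {p : ℝ × ℝ | 0 < p.1} volume) :
    Integrable fun p : ℝ × ℝ => Real.exp p.1 * g (Real.exp p.1, p.2) := by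
  have himage : (fun p : ℝ × ℝ => (Real.exp p.1, p.2)) '' Set.univ = {p : ℝ × ℝ | 0 < p.1} := by
    ext p
    constructor
    · rintro ⟨q, -, rfl⟩
      exact Real.exp_pos _
    · intro hp
      exact ⟨(Real.log p.1, p.2), trivial, by simp [Real.exp_log (show 0 < p.1 from hp)]⟩
  have hinj : Set.InjOn (fun p : ℝ × ℝ => (Real.exp p.1, p.2)) Set.univ := by
    intro p _ q _ h
    simpa [Prod.ext_iff] using h
  have hder (p : ℝ × ℝ) : HasFDerivWithinAt (fun p : ℝ × ℝ => (Real.exp p.1, p.2))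
      ((Real.exp p.1 • ContinuousLinearMap.fst ℝ ℝ ℝ).prod (ContinuousLinearMap.snd ℝ ℝ ℝ))
      Set.univ p :=
    ((hasFDerivAt_fst (𝕜 := ℝ)).exp.prodMk hasFDerivAt_snd).hasFDerivWithinAt
  have := (integrableOn_image_iff_integrableOn_abs_det_fderiv_smul volume MeasurableSet.univ
    (fun p _ => hder p) hinj g).mp (himage ▸ hg)
  simpa [det_smul_fst_prod_snd, integrableOn_univ] using this

/-- Vanishing of weighted-L² solutions of `Δ u + 2 i x ∂_y u + (1 + c) u = 0` on the
hyperbolic half-plane, where `Δ = -x²(∂ₓ² + ∂_y²)` and `u ∈ ρ^δ L²` with `ρ(x,y) = x`. -/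
theorem no_twisted_harmonic_on_halfspace
    (c δ : ℝ) (hc : 0 ≤ c)
    (hδl : -(Real.sqrt (5 + 4 * c)) / 2 < δ)
    (hδu : δ < Real.sqrt (5 + 4 * c) / 2)
    (u : ℝ → ℝ → ℂ)
    (hreg : ContDiffOn ℝ 2 (fun p : ℝ × ℝ => u p.1 p.2) {p : ℝ × ℝ | 0 < p.1})
    (hpde : ∀ x y : ℝ, 0 < x →
      -(x : ℂ) ^ 2 * (iteratedDeriv 2 (fun s => u s y) x + iteratedDeriv 2 (fun s => u x s) y)
        + 2 * Complex.I * (x : ℂ) * deriv (fun s => u x s) y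
        + (1 + (c : ℂ)) * u x y = 0)
    (hint : IntegrableOn
      (fun p : ℝ × ℝ => p.1 ^ (-2 * δ - 2) * ‖u p.1 p.2‖ ^ 2)
      {p : ℝ × ℝ | 0 < p.1} volume) :
    ∀ x y : ℝ, 0 < x → u x y = 0 := by
  set U : ℝ × ℝ → ℂ := fun p => u (Real.exp p.1) p.2 with hUdef
  have hU : ContDiff ℝ 2 U :=
    hreg.comp_contDiff (f := fun p : ℝ × ℝ => (Real.exp p.1, p.2)) (by fun_prop)
      fun p => Real.exp_pos p.1
  have hU1 : Differentiable ℝ U := hU.differentiable two_ne_zero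
  set S : ℝ × ℝ → ℂ := fun p => fderiv ℝ U p (1, 0) with hS
  set Y : ℝ × ℝ → ℂ := fun p => fderiv ℝ U p (0, 1) with hY
  have hSc : ContDiff ℝ 1 S := hU.fderiv_apply_const _
  have hYc : ContDiff ℝ 1 Y := hU.fderiv_apply_const _
  have hS1 : Differentiable ℝ S := hSc.differentiable one_ne_zero
  have hY1 : Differentiable ℝ Y := hYc.differentiable one_ne_zero
  have hcomm (p : ℝ × ℝ) : fderiv ℝ S p (0, 1) = fderiv ℝ Y p (1, 0) := hU.fderiv_fderiv_comm p _ _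
  have hsec (y : ℝ) : ContDiffOn ℝ 2 (fun t => u t y) (Set.Ioi 0) :=
    hreg.comp (f := fun t : ℝ => (t, y)) (by fun_prop) fun t ht => ht
  have hSval (p : ℝ × ℝ) :
      S p = (Real.exp p.1 : ℂ) * deriv (fun t => u t p.2) (Real.exp p.1) := by
    have hd : DifferentiableAt ℝ (fun t => u t p.2) (Real.exp p.1) :=
      ((hsec p.2).differentiableOn two_ne_zero).differentiableAt (Ioi_mem_nhds (Real.exp_pos _))
    have h := (hd.hasDerivAt.scomp p.1 (Real.hasDerivAt_exp p.1)).deriv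
    rw [hS]
    dsimp only
    rw [fderiv_apply_fst (hU1 p)]
    refine h.trans ?_
    rw [Complex.real_smul]
  have hSSval (p : ℝ × ℝ) : fderiv ℝ S p (1, 0) =
      S p + (Real.exp p.1 : ℂ) ^ 2 * iteratedDeriv 2 (fun t => u t p.2) (Real.exp p.1) := by
    have hd : DifferentiableAt ℝ (deriv fun t => u t p.2) (Real.exp p.1) :=
      (((contDiffOn_succ_iff_deriv_of_isOpen (n := 1) isOpen_Ioi).mp
        (by simpa [one_add_one_eq_two] using hsec p.2)).2.2.differentiableOn
          one_ne_zero).differentiableAt (Ioi_mem_nhds (Real.exp_pos _))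
    have h := (((Real.hasDerivAt_exp p.1).ofReal_comp).mul
      (hd.hasDerivAt.scomp p.1 (Real.hasDerivAt_exp p.1))).deriv
    rw [fderiv_apply_fst (hS1 p)]
    simp only [hSval]
    refine h.trans ?_
    rw [iteratedDeriv_succ, iteratedDeriv_one, Complex.real_smul]
    simp only [Function.comp_apply]
    ring
  have hYval (p : ℝ × ℝ) : Y p = deriv (fun t => u (Real.exp p.1) t) p.2 :=
    fderiv_apply_snd (hU1 p)
  have hYYval (p : ℝ × ℝ) :
      fderiv ℝ Y p (0, 1) = iteratedDeriv 2 (fun t => u (Real.exp p.1) t) p.2 := by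
    rw [fderiv_apply_snd (hY1 p), iteratedDeriv_succ, iteratedDeriv_one]
    simp only [hYval]
  have heq (p : ℝ × ℝ) : -(fderiv ℝ S p (1, 0) - S p) - (Real.exp p.1 : ℂ) ^ 2 * fderiv ℝ Y p (0, 1)
      + 2 * Complex.I * (Real.exp p.1 : ℂ) * Y p + (1 + (c : ℂ)) * U p = 0 := by
    rw [hSSval, hYYval, hYval]
    linear_combination hpde (Real.exp p.1) p.2 (Real.exp_pos _)
  have hre {g : ℝ × ℝ → ℂ} (hg : ContDiff ℝ 1 g) : ContDiff ℝ 1 fun p => (g p).re :=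
    Complex.reCLM.contDiff.comp hg
  have him {g : ℝ × ℝ → ℂ} (hg : ContDiff ℝ 1 g) : ContDiff ℝ 1 fun p => (g p).im :=
    Complex.imCLM.contDiff.comp hg
  have hUc : ContDiff ℝ 1 U := hU.of_le one_le_two
  have hSr := hre hSc
  have hSi := him hSc
  have hYr := hre hYc
  have hYi := him hYc
  have hUr := hre hUc
  have hUi := him hUc
  have hsys : TwistedSystem (1 + c) (fun p => (U p).re) (fun p => (U p).im)
      (fun p => (S p).re + Real.exp p.1 * (Y p).im - (U p).re)
      (fun p => (S p).im - Real.exp p.1 * (Y p).re - (U p).im) := by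
    have dE (p : ℝ × ℝ) : HasFDerivAt (fun p : ℝ × ℝ => Real.exp p.1) _ p :=
      (hasFDerivAt_fst (𝕜 := ℝ)).exp
    have d {g : ℝ × ℝ → ℝ} (hg : ContDiff ℝ 1 g) (p : ℝ × ℝ) : HasFDerivAt g (fderiv ℝ g p) p :=
      (hg.differentiable one_ne_zero p).hasFDerivAt
    have dv1 (p : ℝ × ℝ) : HasFDerivAt
        (fun p => (S p).re + Real.exp p.1 * (Y p).im - (U p).re) _ p :=
      ((d hSr p).add ((dE p).mul (d hYi p))).sub (d hUr p)
    have dv2 (p : ℝ × ℝ) : HasFDerivAt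
        (fun p => (S p).im - Real.exp p.1 * (Y p).re - (U p).im) _ p :=
      ((d hSi p).sub ((dE p).mul (d hYr p))).sub (d hUi p)
    refine ⟨hUr, hUi, by fun_prop, by fun_prop, fun p => ?_, fun p => ?_, fun p => ?_, fun p => ?_⟩
    · rw [fderiv_re_apply (hU1 p), fderiv_im_apply (hU1 p)]
      ring
    · rw [fderiv_re_apply (hU1 p), fderiv_im_apply (hU1 p)]
      ring
    · have h := congrArg Complex.re (heq p)
      rw [(dv1 p).fderiv, (dv2 p).fderiv]
      simp [fderiv_re_apply (hU1 p), fderiv_im_apply (hU1 p), fderiv_re_apply (hS1 p),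
        fderiv_im_apply (hS1 p), fderiv_re_apply (hY1 p), fderiv_im_apply (hY1 p), hcomm,
        -Complex.ofReal_exp, ← Complex.ofReal_pow] at h ⊢
      linarith
    · have h := congrArg Complex.im (heq p)
      rw [(dv1 p).fderiv, (dv2 p).fderiv]
      simp [fderiv_re_apply (hU1 p), fderiv_im_apply (hU1 p), fderiv_re_apply (hS1 p),
        fderiv_im_apply (hS1 p), fderiv_re_apply (hY1 p), fderiv_im_apply (hY1 p), hcomm,
        -Complex.ofReal_exp, ← Complex.ofReal_pow] at h ⊢
      linarith
  have hδ : δ ^ 2 < 1 / 4 + (1 + c) := by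
    have h5 : 0 ≤ 5 + 4 * c := by linarith
    nlinarith [Real.sq_sqrt h5]
  have hint' : Integrable fun p : ℝ × ℝ =>
      Real.exp (-(δ + 1 / 2) * p.1) ^ 2 * ((U p).re ^ 2 + (U p).im ^ 2) := by
    convert integrable_comp_exp_fst hint using 2 with p
    rw [← Real.exp_mul, ← mul_assoc, ← Real.exp_add, ← Real.exp_nat_mul, Complex.sq_norm,
      Complex.normSq_apply]
    congr 1
    · congr 1
      push_cast
      ring
    · simp only [hUdef]
      ring
  intro x y hx
  have h := hsys.eq_zero (by linarith) hδ hint' (Real.log x, y)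
  simp only [hUdef, Real.exp_log hx] at h
  exact Complex.ext h.1 h.2
end

section
/- Let λ, ν ∈ ℝ with λ ≠ 0, ν + 2 + λ ≠ 0, and ν + 2 − λ ≠ 0. Suppose u : (0,∞) → ℂ is twice continuously differentiable and satisfies |−u''(r) − u'(r)/r + λ²·u(r)/r²| ≤ r^ν for all r > 0. Then there exist constants c₁, c₂ ∈ ℂ such that |u(r) − c₁·r^λ − c₂·r^(−λ)| ≤ C·r^(ν+2) for all r > 0, where one may take C = 1/(2|λ|·|ν+2+λ|) + 1/(2|λ|·|ν+2−λ|). -/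
/-- A function on `(0, ∞)` whose derivative is dominated by `t ^ (a - 1)` is Lipschitz in the
variable `t ^ a`. -/
theorem norm_sub_le_abs_rpow_sub_rpow {E : Type*} [NormedAddCommGroup E] [NormedSpace ℝ E]
    {a : ℝ} (ha : a ≠ 0) {g g' : ℝ → E}
    (hg : ∀ r : ℝ, 0 < r → HasDerivAt g (g' r) r)
    (hg' : ∀ r : ℝ, 0 < r → ‖g' r‖ ≤ r ^ (a - 1)) {x y : ℝ} (hx : 0 < x) (hy : 0 < y) :
    ‖g y - g x‖ ≤ |y ^ a - x ^ a| / |a| := by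
  wlog hxy : x ≤ y generalizing x y
  · rw [norm_sub_rev, abs_sub_comm]
    exact this hy hx (le_of_not_ge hxy)
  have hB {t : ℝ} (ht : 0 < t) :
      HasDerivAt (fun t : ℝ => (t ^ a - x ^ a) / a) (t ^ (a - 1)) t := by
    have := ((Real.hasDerivAt_rpow_const (p := a) (Or.inl ht.ne')).sub_const
      (x ^ a)).div_const a
    rwa [mul_div_cancel_left₀ _ ha] at this
  have hG {t : ℝ} (ht : 0 < t) : HasDerivAt (fun t => g t - g x) (g' t) t :=
    (hg t ht).sub_const _
  have key : ‖g y - g x‖ ≤ (y ^ a - x ^ a) / a :=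
    image_norm_le_of_norm_deriv_right_le_deriv_boundary'
      (fun t ht => (hG (hx.trans_le ht.1)).continuousAt.continuousWithinAt)
      (fun t ht => (hG (hx.trans_le ht.1)).hasDerivWithinAt)
      (by simp)
      (fun t ht => (hB (hx.trans_le ht.1)).continuousAt.continuousWithinAt)
      (fun t ht => (hB (hx.trans_le ht.1)).hasDerivWithinAt)
      (fun t ht => hg' t (hx.trans_le ht.1)) ⟨hxy, le_rfl⟩
  exact (key.trans (le_abs_self _)).trans_eq (abs_div _ _)

/-- A function on `(0, ∞)` whose derivative is dominated by `t ^ (a - 1)` with `a ≠ 0` differs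
from a constant by at most `t ^ a / |a|`. -/
theorem exists_norm_sub_le_rpow_div {E : Type*} [NormedAddCommGroup E] [NormedSpace ℝ E]
    [CompleteSpace E] {a : ℝ} (ha : a ≠ 0) {g g' : ℝ → E}
    (hg : ∀ r : ℝ, 0 < r → HasDerivAt g (g' r) r)
    (hg' : ∀ r : ℝ, 0 < r → ‖g' r‖ ≤ r ^ (a - 1)) :
    ∃ c : E, ∀ r : ℝ, 0 < r → ‖g r - c‖ ≤ r ^ a / |a| := by
  set x : ℕ → ℝ := fun n => (1 / ((n : ℝ) + 1)) ^ a⁻¹ with hx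
  have hx0 (n : ℕ) : 0 < x n := by positivity
  have hxa (n : ℕ) : x n ^ a = 1 / ((n : ℝ) + 1) :=
    Real.rpow_inv_rpow (by positivity) ha
  have hlim : Filter.Tendsto (fun n => x n ^ a) Filter.atTop (nhds 0) := by
    simpa only [hxa] using tendsto_one_div_add_atTop_nhds_zero_nat (𝕜 := ℝ)
  have hcauchy : CauchySeq fun n => g (x n) := by
    refine cauchySeq_of_le_tendsto_0 (fun N => x N ^ a / |a|) (fun n m N hn hm => ?_)
      (by simpa using hlim.div_const |a|)
    rw [dist_eq_norm]
    refine (norm_sub_le_abs_rpow_sub_rpow ha hg hg' (hx0 m) (hx0 n)).trans ?_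
    have hmono {k : ℕ} (hk : N ≤ k) : x k ^ a ≤ x N ^ a := by
      rw [hxa, hxa]
      exact Nat.one_div_le_one_div hk
    gcongr
    exact abs_sub_le_of_nonneg_of_le (by have := hx0 n; positivity) (hmono hn)
      (by have := hx0 m; positivity) (hmono hm)
  obtain ⟨c, hc⟩ := cauchySeq_tendsto_of_complete hcauchy
  refine ⟨c, fun r hr => ?_⟩
  have hbound : Filter.Tendsto (fun n => |r ^ a - x n ^ a| / |a|) Filter.atTop
      (nhds (r ^ a / |a|)) := by
    have := ((hlim.const_sub (r ^ a)).abs).div_const |a|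
    rwa [sub_zero, abs_of_nonneg (Real.rpow_nonneg hr.le a)] at this
  exact le_of_tendsto_of_tendsto' (hc.const_sub (g r)).norm hbound
    fun n => norm_sub_le_abs_rpow_sub_rpow ha hg hg' (hx0 n) hr

/-- For a root `μ` of `μ ^ 2 = lam ^ 2`, the first-order expression `r ^ μ (μ u - r u')` is a
primitive of `r ^ (μ + 1)` times the radial operator `-u'' - u' / r + lam ^ 2 u / r ^ 2`. -/
theorem hasDerivAt_rpow_mul_radial {lam μ : ℝ} (hμ : μ ^ 2 = lam ^ 2) {u u' : ℝ → ℂ} {v : ℂ}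
    {r : ℝ} (hr : 0 < r) (hd1 : HasDerivAt u (u' r) r) (hd2 : HasDerivAt u' v r) :
    HasDerivAt (fun t : ℝ => ((t ^ μ : ℝ) : ℂ) * ((μ : ℂ) * u t - (t : ℂ) * u' t))
      (((r ^ (μ + 1) : ℝ) : ℂ) *
        (-v - u' r / (r : ℂ) + (lam : ℂ) ^ 2 * u r / (r : ℂ) ^ 2)) r := by
  have hp : HasDerivAt (fun t : ℝ => ((t ^ μ : ℝ) : ℂ)) ((μ * r ^ (μ - 1) : ℝ) : ℂ) r :=
    (Real.hasDerivAt_rpow_const (Or.inl hr.ne')).ofReal_comp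
  have hid : HasDerivAt (fun t : ℝ => (t : ℂ)) 1 r := (hasDerivAt_id r).ofReal_comp
  have hprod := hp.mul ((hd1.const_mul (μ : ℂ)).sub (hid.mul hd2))
  refine hprod.congr_deriv ?_
  have hrc : (r : ℂ) ≠ 0 := by exact_mod_cast hr.ne'
  have hμc : (lam : ℂ) ^ 2 = (μ : ℂ) ^ 2 := by exact_mod_cast hμ.symm
  rw [hμc, Real.rpow_sub_one hr.ne', Real.rpow_add_one hr.ne']
  push_cast
  simp only [Pi.mul_apply, Pi.sub_apply]
  field_simp
  ring

/-- A solution of `-u'' - u'/r + λ² u / r²  = f` with `|f(r)| ≤ r^ν` differs from a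
solution `c₁ r^λ + c₂ r^(-λ)` of the homogeneous equation by at most `C r^(ν+2)`, where
`C = 1/(2|λ||ν+2+λ|) + 1/(2|λ||ν+2-λ|)`. -/
theorem laplacian_bound
    (lam ν : ℝ) (hlam : lam ≠ 0) (h₁ : ν + 2 + lam ≠ 0) (h₂ : ν + 2 - lam ≠ 0)
    (u u' u'' : ℝ → ℂ)
    (hd1 : ∀ r : ℝ, 0 < r → HasDerivAt u (u' r) r)
    (hd2 : ∀ r : ℝ, 0 < r → HasDerivAt u' (u'' r) r)
    (hcont : ContinuousOn u'' (Set.Ioi (0 : ℝ)))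
    (hineq : ∀ r : ℝ, 0 < r →
      ‖-u'' r - u' r / (r : ℂ) + (lam : ℂ) ^ 2 * u r / (r : ℂ) ^ 2‖ ≤ r ^ ν) :
    ∃ c₁ c₂ : ℂ, ∀ r : ℝ, 0 < r →
      ‖u r - c₁ * ((r ^ lam : ℝ) : ℂ) - c₂ * ((r ^ (-lam) : ℝ) : ℂ)‖ ≤
        (1 / (2 * |lam| * |ν + 2 + lam|) + 1 / (2 * |lam| * |ν + 2 - lam|)) * r ^ (ν + 2) := by
  have main (μ : ℝ) (hμ : μ ^ 2 = lam ^ 2) (ha : ν + 2 + μ ≠ 0) :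
      ∃ c : ℂ, ∀ r : ℝ, 0 < r →
        ‖((r ^ μ : ℝ) : ℂ) * ((μ : ℂ) * u r - (r : ℂ) * u' r) - c‖ ≤
          r ^ (ν + 2 + μ) / |ν + 2 + μ| := by
    refine exists_norm_sub_le_rpow_div ha
      (fun r hr => hasDerivAt_rpow_mul_radial hμ hr (hd1 r hr) (hd2 r hr)) fun r hr => ?_
    rw [norm_mul, Complex.norm_of_nonneg (by positivity)]
    calc r ^ (μ + 1) * _ ≤ r ^ (μ + 1) * r ^ ν := by gcongr; exact hineq r hr
      _ = r ^ (ν + 2 + μ - 1) := by rw [← Real.rpow_add hr]; ring_nf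
  obtain ⟨c, hc⟩ := main lam rfl h₁
  obtain ⟨d, hd⟩ := main (-lam) (neg_sq lam) h₂
  refine ⟨-d / (2 * lam), c / (2 * lam), fun r hr => ?_⟩
  have hlc : (lam : ℂ) ≠ 0 := by exact_mod_cast hlam
  have hmul : ((r ^ lam : ℝ) : ℂ) * ((r ^ (-lam) : ℝ) : ℂ) = 1 := by
    rw [← Complex.ofReal_mul, ← Real.rpow_add hr]
    simp
  have hsplit : u r - -d / (2 * lam) * ((r ^ lam : ℝ) : ℂ)
        - c / (2 * lam) * ((r ^ (-lam) : ℝ) : ℂ) =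
      (((r ^ (-lam) : ℝ) : ℂ) *
          (((r ^ lam : ℝ) : ℂ) * ((lam : ℂ) * u r - (r : ℂ) * u' r) - c) -
        ((r ^ lam : ℝ) : ℂ) *
          (((r ^ (-lam) : ℝ) : ℂ) * (((-lam : ℝ) : ℂ) * u r - (r : ℂ) * u' r) - d)) /
        (2 * lam) := by
    push_cast
    field_simp
    linear_combination (-2 * (lam : ℂ) * u r) * hmul
  have hnorm : ‖(2 * lam : ℂ)‖ = 2 * |lam| := by simp
  rw [hsplit, norm_div, hnorm]
  have hlpos : 0 < |lam| := abs_pos.mpr hlam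
  calc _ ≤ (r ^ (-lam) * (r ^ (ν + 2 + lam) / |ν + 2 + lam|) +
        r ^ lam * (r ^ (ν + 2 + -lam) / |ν + 2 + -lam|)) / (2 * |lam|) := by
        gcongr
        refine (norm_sub_le _ _).trans ?_
        rw [norm_mul, norm_mul, Complex.norm_of_nonneg (by positivity),
          Complex.norm_of_nonneg (by positivity)]
        gcongr
        · exact hc r hr
        · exact hd r hr
    _ = _ := by
        have e₁ : r ^ (-lam) * r ^ (ν + 2 + lam) = r ^ (ν + 2) := by
          rw [← Real.rpow_add hr]; ring_nf
        have e₂ : r ^ lam * r ^ (ν + 2 + -lam) = r ^ (ν + 2) := by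
          rw [← Real.rpow_add hr]; ring_nf
        rw [← mul_div_assoc, ← mul_div_assoc, e₁, e₂, ← sub_eq_add_neg]
        have := abs_pos.mpr h₁
        have := abs_pos.mpr h₂
        field_simp
end

section
/- Suppose u : (0,∞) × ℝ → ℝ and v : (0,∞) × ℝ → ℂ are twice continuously differentiable, 2π-periodic in the second (angular) variable θ, and bounded. Suppose that for all r > 0 and all θ: −∂²u/∂r² − (1/r)·∂u/∂r − (1/r²)·∂²u/∂θ² + 16·r·u = 0 and −∂²v/∂r² − (1/r)·∂v/∂r − (1/r²)·(∂²v/∂θ² + i·∂v/∂θ − v/4) + 8·r·v − 8·r·e^(−iθ)·conj(v) = 0. Then u is identically zero and v is identically zero. -/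
open Set

/-- Differentiation under the integral sign on a half plane. -/
theorem hasDerivAt_integral_of_continuousOn_pos {F F' : ℝ → ℝ → ℝ} (a b : ℝ)
    (hF : ∀ r, 0 < r → Continuous (F r))
    (hF' : ContinuousOn (fun p : ℝ × ℝ => F' p.1 p.2) {p | 0 < p.1})
    (hd : ∀ r θ, 0 < r → HasDerivAt (fun s => F s θ) (F' r θ) r) {r : ℝ} (hr : 0 < r) :
    HasDerivAt (fun s => ∫ θ in a..b, F s θ) (∫ θ in a..b, F' r θ) r := by
  have hslice : ∀ s, 0 < s → Continuous (F' s) := fun s hs =>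
    hF'.comp_continuous (by fun_prop : Continuous fun θ : ℝ => (s, θ)) fun _ => hs
  obtain ⟨C, hC⟩ := (isCompact_Icc.prod isCompact_uIcc :
    IsCompact (Icc (r / 2) (2 * r) ×ˢ uIcc a b)).exists_bound_of_continuousOn
    (hF'.mono fun p hp => by
      have := hp.1.1
      change 0 < p.1
      linarith)
  have hs : Icc (r / 2) (2 * r) ∈ nhds r := Icc_mem_nhds (by linarith) (by linarith)
  refine (intervalIntegral.hasDerivAt_integral_of_dominated_loc_of_deriv_le
    (bound := fun _ => C) hs ?_ ((hF r hr).intervalIntegrable _ _)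
    (hslice r hr).aestronglyMeasurable ?_ intervalIntegrable_const ?_).2
  · filter_upwards [lt_mem_nhds hr] with s hs using (hF s hs).aestronglyMeasurable
  · exact .of_forall fun θ hθ s hs => hC (s, θ) ⟨hs, uIoc_subset_uIcc hθ⟩
  · exact .of_forall fun θ _ s hs => hd s θ (by linarith [hs.1])

/-- A bounded function on the line with monotone derivative has zero derivative. -/
theorem deriv_eq_zero_of_bounded_of_monotone {f f' : ℝ → ℝ} {M : ℝ}
    (hd : ∀ t, HasDerivAt f (f' t) t) (hmono : Monotone f') (hbd : ∀ t, |f t| ≤ M) (t : ℝ) :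
    f' t = 0 := by
  have slope : ∀ x y, x < y → f' x * (y - x) ≤ f y - f x ∧ f y - f x ≤ f' y * (y - x) := by
    intro x y hxy
    obtain ⟨c, hc, hceq⟩ := exists_hasDerivAt_eq_slope f f' hxy
      (fun z _ => (hd z).continuousAt.continuousWithinAt) (fun z _ => hd z)
    have hpos : 0 < y - x := sub_pos.2 hxy
    rw [eq_div_iff hpos.ne'] at hceq
    rw [← hceq]
    exact ⟨mul_le_mul_of_nonneg_right (hmono hc.1.le) hpos.le,
      mul_le_mul_of_nonneg_right (hmono hc.2.le) hpos.le⟩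
  have hM : 0 ≤ M := (abs_nonneg _).trans (hbd t)
  rcases lt_trichotomy (f' t) 0 with h | h | h
  · have hpos : 0 < (2 * M + 1) / -f' t := div_pos (by linarith) (by linarith)
    have := (slope (t - (2 * M + 1) / -f' t) t (by linarith)).2
    have e : f' t * (t - (t - (2 * M + 1) / -f' t)) = -(2 * M + 1) := by
      field_simp [h.ne]; ring
    linarith [abs_le.1 (hbd t), abs_le.1 (hbd (t - (2 * M + 1) / -f' t))]
  · exact h
  · have hpos : 0 < (2 * M + 1) / f' t := div_pos (by linarith) h
    have := (slope t (t + (2 * M + 1) / f' t) (by linarith)).1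
    have e : f' t * (t + (2 * M + 1) / f' t - t) = 2 * M + 1 := by
      field_simp [h.ne']; ring
    linarith [abs_le.1 (hbd t), abs_le.1 (hbd (t + (2 * M + 1) / f' t))]

/-- A Liouville-type theorem in polar coordinates: a bounded density `F` whose scaled radial
derivative `G = r ∂ᵣF` satisfies `r ∂ᵣG + ∂_θ H = E` with `E ≥ 0` and `H` periodic forces
`E = 0`. -/
theorem eq_zero_of_bounded_of_divergence {F G K H H' E : ℝ → ℝ → ℝ} {T M : ℝ} (hT : 0 < T)
    (hFc : ∀ r, 0 < r → Continuous (F r))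
    (hGc : ContinuousOn (fun p : ℝ × ℝ => G p.1 p.2) {p | 0 < p.1})
    (hKc : ContinuousOn (fun p : ℝ × ℝ => K p.1 p.2) {p | 0 < p.1})
    (hHc : ContinuousOn (fun p : ℝ × ℝ => H' p.1 p.2) {p | 0 < p.1})
    (hF : ∀ r θ, 0 < r → HasDerivAt (fun s => F s θ) (G r θ / r) r)
    (hG : ∀ r θ, 0 < r → HasDerivAt (fun s => G s θ) (K r θ) r)
    (hH : ∀ r θ, 0 < r → HasDerivAt (H r) (H' r θ) θ)
    (hper : ∀ r, 0 < r → Function.Periodic (H r) T)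
    (hE : ∀ r θ, 0 < r → r * K r θ + H' r θ = E r θ)
    (hE0 : ∀ r θ, 0 < r → 0 ≤ E r θ)
    (hbd : ∀ r θ, 0 < r → |F r θ| ≤ M) {r : ℝ} (θ : ℝ) (hr : 0 < r) : E r θ = 0 := by
  have hslice : ∀ {f : ℝ → ℝ → ℝ}, ContinuousOn (fun p : ℝ × ℝ => f p.1 p.2) {p | 0 < p.1} →
      ∀ s, 0 < s → Continuous (f s) := fun hf s hs =>
    hf.comp_continuous (by fun_prop : Continuous fun θ : ℝ => (s, θ)) fun _ => hs
  have hEc : ∀ s, 0 < s → Continuous (E s) := fun s hs => by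
    rw [show E s = fun x => s * K s x + H' s x from funext fun x => (hE s x hs).symm]
    exact (continuous_const.mul (hslice hKc s hs)).add (hslice hHc s hs)
  set N : ℝ → ℝ := fun s => ∫ x in θ..θ + T, F s x
  set P : ℝ → ℝ := fun s => ∫ x in θ..θ + T, G s x
  have hN : ∀ s, 0 < s → HasDerivAt N (P s / s) s := fun s hs => by
    have := hasDerivAt_integral_of_continuousOn_pos (F' := fun r x => G r x / r) θ (θ + T) hFc
      (hGc.div continuousOn_fst fun p hp => ne_of_gt hp) hF hs
    rwa [intervalIntegral.integral_div] at this
  have hP : ∀ s, 0 < s → HasDerivAt P ((∫ x in θ..θ + T, E s x) / s) s := fun s hs => by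
    have h := hasDerivAt_integral_of_continuousOn_pos θ (θ + T) (hslice hGc) hKc hG hs
    have hH0 : ∫ x in θ..θ + T, H' s x = 0 := by
      rw [intervalIntegral.integral_eq_sub_of_hasDerivAt (fun x _ => hH s x hs)
        ((hslice hHc s hs).intervalIntegrable _ _), hper s hs, sub_self]
    convert h using 1
    rw [div_eq_iff hs.ne', intervalIntegral.integral_congr fun x _ => (hE s x hs).symm,
      intervalIntegral.integral_add
        (((hslice hKc s hs).const_mul s).intervalIntegrable _ _)
        ((hslice hHc s hs).intervalIntegrable _ _), hH0, intervalIntegral.integral_const_mul]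
    ring
  have hI0 : ∀ s, 0 < s → 0 ≤ ∫ x in θ..θ + T, E s x := fun s hs =>
    intervalIntegral.integral_nonneg (by linarith) fun x _ => hE0 s x hs
  have hNexp : ∀ t, HasDerivAt (fun t => N (Real.exp t)) (P (Real.exp t)) t := fun t => by
    have := (hN _ (Real.exp_pos t)).comp t (Real.hasDerivAt_exp t)
    rwa [div_mul_cancel₀ _ (Real.exp_pos t).ne'] at this
  have hPexp : ∀ t, HasDerivAt (fun t => P (Real.exp t))
      (∫ x in θ..θ + T, E (Real.exp t) x) t := fun t => by
    have := (hP _ (Real.exp_pos t)).comp t (Real.hasDerivAt_exp t)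
    rwa [div_mul_cancel₀ _ (Real.exp_pos t).ne'] at this
  have hmono : Monotone fun t => P (Real.exp t) :=
    monotone_of_hasDerivAt_nonneg hPexp fun t => hI0 _ (Real.exp_pos t)
  have hPz : ∀ t, P (Real.exp t) = 0 :=
    deriv_eq_zero_of_bounded_of_monotone (M := M * |θ + T - θ|) hNexp hmono fun t => by
      rw [← Real.norm_eq_abs (N _)]
      exact intervalIntegral.norm_integral_le_of_norm_le_const
        fun x _ => hbd _ x (Real.exp_pos t)
  have hzero : ∫ x in θ..θ + T, E r x = 0 := by
    have h := hPexp (Real.log r)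
    rw [Real.exp_log hr, show (fun t => P (Real.exp t)) = fun _ => 0 from funext hPz] at h
    exact h.unique (hasDerivAt_const _ _)
  by_contra hne
  have hpos : 0 < ∫ x in θ..θ + T, E r x :=
    intervalIntegral.integral_pos (by linarith) (hEc r hr).continuousOn
      (fun x _ => hE0 r x hr)
      ⟨θ, left_mem_Icc.2 (by linarith), lt_of_le_of_ne (hE0 r θ hr) (Ne.symm hne)⟩
  exact hpos.ne' hzero

/-- A bounded periodic solution of `∂ᵣ²w + r⁻¹∂ᵣw + r⁻²(∂_θ + ic)²w = g` with
`Re(conj(w) g) ≥ 0` satisfies `(∂_θ + ic)w = 0` and `Re(conj(w) g) = 0`. -/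
theorem twisted_laplace_liouville {w wr wrr wt wtt g : ℝ → ℝ → ℂ} {c T M : ℝ} (hT : 0 < T)
    (hw : ContinuousOn (fun p : ℝ × ℝ => w p.1 p.2) {p | 0 < p.1})
    (hwr : ContinuousOn (fun p : ℝ × ℝ => wr p.1 p.2) {p | 0 < p.1})
    (hwrr : ContinuousOn (fun p : ℝ × ℝ => wrr p.1 p.2) {p | 0 < p.1})
    (hwt : ContinuousOn (fun p : ℝ × ℝ => wt p.1 p.2) {p | 0 < p.1})
    (hwtt : ContinuousOn (fun p : ℝ × ℝ => wtt p.1 p.2) {p | 0 < p.1})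
    (dr : ∀ r θ, 0 < r → HasDerivAt (fun s => w s θ) (wr r θ) r)
    (drr : ∀ r θ, 0 < r → HasDerivAt (fun s => wr s θ) (wrr r θ) r)
    (dt : ∀ r θ, 0 < r → HasDerivAt (w r) (wt r θ) θ)
    (dtt : ∀ r θ, 0 < r → HasDerivAt (wt r) (wtt r θ) θ)
    (hper : ∀ r θ, w r (θ + T) = w r θ)
    (hbd : ∀ r θ, 0 < r → ‖w r θ‖ ≤ M)
    (hpde : ∀ r θ : ℝ, 0 < r → (r : ℂ) ^ 2 * wrr r θ + r * wr r θ + (wtt r θ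
      + 2 * Complex.I * c * wt r θ - (c : ℂ) ^ 2 * w r θ) = (r : ℂ) ^ 2 * g r θ)
    (hg : ∀ r θ, 0 < r → 0 ≤ inner ℝ (w r θ) (g r θ)) {r : ℝ} (θ : ℝ) (hr : 0 < r) :
    wt r θ = -(Complex.I * c) * w r θ ∧ inner ℝ (w r θ) (g r θ) = 0 := by
  have hwt_per : ∀ r, 0 < r → Function.Periodic (wt r) T := fun r hr x => by
    have h := (dt r (x + T) hr).comp_add_const x T
    simp only [hper] at h
    exact h.unique (dt r x hr)
  have key := eq_zero_of_bounded_of_divergence (T := T) (M := M ^ 2)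
    (F := fun r θ => ‖w r θ‖ ^ 2)
    (G := fun r θ => r * (2 * inner ℝ (w r θ) (wr r θ)))
    (K := fun r θ => 1 * (2 * inner ℝ (w r θ) (wr r θ)) +
      r * (2 * (inner ℝ (w r θ) (wrr r θ) + inner ℝ (wr r θ) (wr r θ))))
    (H := fun r θ => 2 * inner ℝ (w r θ) (wt r θ))
    (H' := fun r θ => 2 * (inner ℝ (w r θ) (wtt r θ) + inner ℝ (wt r θ) (wt r θ)))
    (E := fun r θ => 2 * r ^ 2 * ‖wr r θ‖ ^ 2 + 2 * ‖wt r θ + Complex.I * c * w r θ‖ ^ 2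
      + 2 * r ^ 2 * inner ℝ (w r θ) (g r θ))
    hT
    (fun r hr => ((hw.comp_continuous (by fun_prop : Continuous fun θ : ℝ => (r, θ))
      fun _ => hr).norm).pow 2)
    (by fun_prop) (by fun_prop) (by fun_prop)
    (fun r θ hr => by
      rw [mul_div_cancel_left₀ _ hr.ne']
      exact (dr r θ hr).norm_sq)
    (fun r θ hr => (hasDerivAt_id r).mul (((dr r θ hr).inner ℝ (drr r θ hr)).const_mul 2))
    (fun r θ hr => ((dt r θ hr).inner ℝ (dtt r θ hr)).const_mul 2)
    (fun r hr x => by simp only [hper, hwt_per r hr x])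
    (fun r θ hr => by
      have h := hpde r θ hr
      have h1 := congrArg Complex.re h
      have h2 := congrArg Complex.im h
      rw [← Complex.ofReal_pow, ← Complex.ofReal_pow] at h1 h2
      simp only [Complex.inner, Complex.sq_norm, Complex.normSq_apply, Complex.mul_re,
        Complex.mul_im, Complex.add_re, Complex.add_im, Complex.sub_re, Complex.sub_im,
        Complex.conj_re, Complex.conj_im, Complex.ofReal_re, Complex.ofReal_im,
        Complex.I_re, Complex.I_im, Complex.re_ofNat, Complex.im_ofNat] at h1 h2 ⊢
      linear_combination 2 * (w r θ).re * h1 + 2 * (w r θ).im * h2)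
    (fun r θ hr => by have := hg r θ hr; positivity)
    (fun r θ hr => by
      rw [abs_of_nonneg (by positivity)]
      exact pow_le_pow_left₀ (norm_nonneg _) (hbd r θ hr) 2) θ hr
  have hgr := hg r θ hr
  have h1 : 0 ≤ 2 * r ^ 2 * ‖wr r θ‖ ^ 2 := by positivity
  have h2 : 0 ≤ 2 * ‖wt r θ + Complex.I * c * w r θ‖ ^ 2 := by positivity
  have h3 : 0 ≤ 2 * r ^ 2 * inner ℝ (w r θ) (g r θ) := by positivity
  constructor
  · have : ‖wt r θ + Complex.I * c * w r θ‖ ^ 2 = 0 := by linarith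
    have := norm_eq_zero.1 (pow_eq_zero_iff two_ne_zero |>.1 this)
    linear_combination this
  · have : 2 * r ^ 2 * inner ℝ (w r θ) (g r θ) = 0 := by linarith
    exact (mul_eq_zero.1 this).resolve_left (by positivity)

/-- Partial derivatives along a line of a `C¹` function on a half plane. -/
theorem ContDiffOn.hasDerivAt_fst_snd {E : Type*} [NormedAddCommGroup E] [NormedSpace ℝ E]
    {f : ℝ → ℝ → E} {n : WithTop ℕ∞}
    (hf : ContDiffOn ℝ (n + 1) (fun p : ℝ × ℝ => f p.1 p.2) {p | 0 < p.1}) :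
    (ContDiffOn ℝ n (fun p : ℝ × ℝ => deriv (fun s => f s p.2) p.1) {p | 0 < p.1} ∧
      ∀ r θ, 0 < r → HasDerivAt (fun s => f s θ) (deriv (fun s => f s θ) r) r) ∧
    (ContDiffOn ℝ n (fun p : ℝ × ℝ => deriv (f p.1) p.2) {p | 0 < p.1} ∧
      ∀ r θ, 0 < r → HasDerivAt (f r) (deriv (f r) θ) θ) := by
  have hopen : IsOpen {p : ℝ × ℝ | 0 < p.1} := isOpen_lt continuous_const continuous_fst
  have hfd : ∀ r θ : ℝ, 0 < r → HasFDerivAt (fun p : ℝ × ℝ => f p.1 p.2)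
      (fderiv ℝ (fun p : ℝ × ℝ => f p.1 p.2) (r, θ)) (r, θ) := fun r θ hr =>
    ((hf.contDiffAt (hopen.mem_nhds hr)).differentiableAt (by simp)).hasFDerivAt
  have h1 : ∀ r θ : ℝ, 0 < r → HasDerivAt (fun s => f s θ)
      (fderiv ℝ (fun p : ℝ × ℝ => f p.1 p.2) (r, θ) (1, 0)) r := fun r θ hr =>
    HasFDerivAt.comp_hasDerivAt (f := fun s => (s, θ)) r (hfd r θ hr)
      ((hasDerivAt_id r).prodMk (hasDerivAt_const r θ))
  have h2 : ∀ r θ : ℝ, 0 < r → HasDerivAt (f r)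
      (fderiv ℝ (fun p : ℝ × ℝ => f p.1 p.2) (r, θ) (0, 1)) θ := fun r θ hr =>
    HasFDerivAt.comp_hasDerivAt (f := fun t => (r, t)) θ (hfd r θ hr)
      ((hasDerivAt_const θ r).prodMk (hasDerivAt_id θ))
  have hc := hf.fderiv_of_isOpen hopen le_rfl
  exact ⟨⟨(hc.clm_apply contDiffOn_const).congr fun p hp => (h1 p.1 p.2 hp).deriv,
      fun r θ hr => (h1 r θ hr).differentiableAt.hasDerivAt⟩,
    ⟨(hc.clm_apply contDiffOn_const).congr fun p hp => (h2 p.1 p.2 hp).deriv,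
      fun r θ hr => (h2 r θ hr).differentiableAt.hasDerivAt⟩⟩


/-- Vanishing of bounded solutions of the linearized equation at the limiting fiducial
solution, written in polar coordinates `(r, θ)`:
`Δ u + 16 r u = 0` and `Δ_{1/2} v + 8 r v - 8 r e^{-iθ} conj(v) = 0`,
where `Δ = -∂ᵣ² - r⁻¹∂ᵣ - r⁻²∂_θ²` and `Δ_{1/2} = -∂ᵣ² - r⁻¹∂ᵣ - r⁻²(∂_θ + i/2)²`. -/
theorem no_limiting_fiducial_kernel
    (u : ℝ → ℝ → ℝ) (v : ℝ → ℝ → ℂ)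
    (hregu : ContDiffOn ℝ 2 (fun p : ℝ × ℝ => u p.1 p.2) {p : ℝ × ℝ | 0 < p.1})
    (hregv : ContDiffOn ℝ 2 (fun p : ℝ × ℝ => v p.1 p.2) {p : ℝ × ℝ | 0 < p.1})
    (hperu : ∀ r θ : ℝ, u r (θ + 2 * Real.pi) = u r θ)
    (hperv : ∀ r θ : ℝ, v r (θ + 2 * Real.pi) = v r θ)
    (hbd : ∃ M : ℝ, ∀ r θ : ℝ, 0 < r → |u r θ| ≤ M ∧ ‖v r θ‖ ≤ M)
    (hpdeu : ∀ r θ : ℝ, 0 < r →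
      -(iteratedDeriv 2 (fun s => u s θ) r) - (deriv (fun s => u s θ) r) / r
        - (iteratedDeriv 2 (fun t => u r t) θ) / r ^ 2 + 16 * r * u r θ = 0)
    (hpdev : ∀ r θ : ℝ, 0 < r →
      -(iteratedDeriv 2 (fun s => v s θ) r) - (deriv (fun s => v s θ) r) / (r : ℂ)
        - ((r : ℂ) ^ 2)⁻¹ * (iteratedDeriv 2 (fun t => v r t) θ
            + Complex.I * deriv (fun t => v r t) θ - v r θ / 4)
        + 8 * (r : ℂ) * v r θ
        - 8 * (r : ℂ) * Complex.exp (-Complex.I * (θ : ℂ)) * (starRingEnd ℂ) (v r θ) = 0) :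
    ∀ r θ : ℝ, 0 < r → u r θ = 0 ∧ v r θ = 0 := by
  have hpi := Real.two_pi_pos
  obtain ⟨M, hM⟩ := hbd
  intro r θ hr
  constructor
  · obtain ⟨⟨ur, dur⟩, ⟨ut, dut⟩⟩ := ContDiffOn.hasDerivAt_fst_snd (f := u) (n := 1) hregu
    obtain ⟨⟨urr, durr⟩, -⟩ :=
      ContDiffOn.hasDerivAt_fst_snd (f := fun r θ => deriv (fun s => u s θ) r) (n := 0) ur
    obtain ⟨-, ⟨utt, dutt⟩⟩ :=
      ContDiffOn.hasDerivAt_fst_snd (f := fun r θ => deriv (u r) θ) (n := 0) ut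
    have key := (twisted_laplace_liouville (c := 0) (g := fun r θ => (16 * r * u r θ : ℝ)) hpi
      (Complex.continuous_ofReal.comp_continuousOn hregu.continuousOn)
      (Complex.continuous_ofReal.comp_continuousOn ur.continuousOn)
      (Complex.continuous_ofReal.comp_continuousOn urr.continuousOn)
      (Complex.continuous_ofReal.comp_continuousOn ut.continuousOn)
      (Complex.continuous_ofReal.comp_continuousOn utt.continuousOn)
      (fun r θ hr => (dur r θ hr).ofReal_comp) (fun r θ hr => (durr r θ hr).ofReal_comp)
      (fun r θ hr => (dut r θ hr).ofReal_comp) (fun r θ hr => (dutt r θ hr).ofReal_comp)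
      (fun r θ => by simp only [hperu])
      (fun r θ hr => by simpa using (hM r θ hr).1)
      (fun r θ hr => by
        have h := hpdeu r θ hr
        simp only [iteratedDeriv_succ, iteratedDeriv_zero] at h
        field_simp at h
        have hc := congrArg Complex.ofReal h
        push_cast at hc ⊢
        linear_combination -hc)
      (fun r θ hr => by
        simp only [Complex.inner, Complex.conj_ofReal, ← Complex.ofReal_mul,
          Complex.ofReal_re]
        nlinarith [mul_nonneg hr.le (sq_nonneg (u r θ))]) θ hr).2
    simp only [Complex.inner, Complex.conj_ofReal, ← Complex.ofReal_mul,
      Complex.ofReal_re] at key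
    simpa [hr.ne'] using key
  · obtain ⟨⟨vr, dvr⟩, ⟨vt, dvt⟩⟩ := ContDiffOn.hasDerivAt_fst_snd (f := v) (n := 1) hregv
    obtain ⟨⟨vrr, dvrr⟩, -⟩ :=
      ContDiffOn.hasDerivAt_fst_snd (f := fun r θ => deriv (fun s => v s θ) r) (n := 0) vr
    obtain ⟨-, ⟨vtt, dvtt⟩⟩ :=
      ContDiffOn.hasDerivAt_fst_snd (f := fun r θ => deriv (v r) θ) (n := 0) vt
    have key : ∀ x, deriv (v r) x = -(Complex.I * (1 / 2 : ℝ)) * v r x := fun x =>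
      (twisted_laplace_liouville (c := 1 / 2)
      (g := fun r θ => ((8 * r : ℝ) : ℂ) * (v r θ -
        Complex.exp (-Complex.I * (θ : ℂ)) * (starRingEnd ℂ) (v r θ))) hpi
      hregv.continuousOn vr.continuousOn vrr.continuousOn vt.continuousOn vtt.continuousOn
      dvr dvrr dvt dvtt hperv (fun r θ hr => (hM r θ hr).2)
      (fun r θ hr => by
        have h := hpdev r θ hr
        have hr' : (r : ℂ) ≠ 0 := Complex.ofReal_ne_zero.2 hr.ne'
        simp only [iteratedDeriv_succ, iteratedDeriv_zero] at h
        field_simp at h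
        push_cast
        rw [neg_mul]
        linear_combination (-1 / 4 : ℂ) * h)
      (fun r θ hr => by
        rw [← Complex.real_smul, real_inner_smul_right, inner_sub_right,
          real_inner_self_eq_norm_sq]
        refine mul_nonneg (by positivity) (sub_nonneg.2 ((real_inner_le_norm _ _).trans ?_))
        rw [norm_mul, RCLike.norm_conj, show -Complex.I * (θ : ℂ) = ((-θ : ℝ) : ℂ) * Complex.I by
          push_cast; ring, Complex.norm_exp_ofReal_mul_I, one_mul, sq]) x hr).1
    have hconst : ∀ x, HasDerivAt (fun x : ℝ => Complex.exp ((x / 2 : ℝ) * Complex.I) * v r x)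
        0 x := fun x => by
      have he := ((((hasDerivAt_id x).div_const 2).ofReal_comp).mul_const Complex.I).cexp
      refine (he.mul (dvt r x hr)).congr_deriv ?_
      rw [key]
      push_cast
      ring
    have h := is_const_of_deriv_eq_zero (fun x => (hconst x).differentiableAt)
      (fun x => (hconst x).deriv) (θ + 2 * Real.pi) θ
    have hexp : Complex.exp (((θ + 2 * Real.pi) / 2 : ℝ) * Complex.I)
        = -Complex.exp ((θ / 2 : ℝ) * Complex.I) := by
      rw [show (((θ + 2 * Real.pi) / 2 : ℝ) : ℂ) * Complex.I
        = (θ / 2 : ℝ) * Complex.I + Real.pi * Complex.I by push_cast; ring,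
        Complex.exp_add, Complex.exp_pi_mul_I, mul_neg_one]
    simp only [hperv, hexp] at h
    have h0 : Complex.exp ((θ / 2 : ℝ) * Complex.I) * v r θ = 0 := by
      linear_combination (-1 / 2 : ℂ) * h
    exact (mul_eq_zero.1 h0).resolve_left (Complex.exp_ne_zero _)
end
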